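/- arXiv:2411.06940 — 2 statements merged into one kernel-verified Lean document; each statement's English description precedes it below -/
import Mathlib

section
/- If Ω ⊂ ℝ² is a bounded C²-regular domain, then at least one of the following two conditions holds: (i) ‖κ‖_{L∞(∂Ω)} = 1/r_Ω; (ii) there are points x, y ∈ ∂Ω such that y = x ± 2 r_Ω ν(x) and ν(x) = −ν(y). -/
open MeasureTheory Metric Set Filter
open scoped RealInnerProductSpace ENNReal Topology NNReal

noncomputable section

abbrev E2 : Type := EuclideanSpace ℝ (Fin 2)

namespace StokesPaper

/-- The `i`-th standard basis vector of `ℝ²`. -/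
def e (i : Fin 2) : E2 := EuclideanSpace.single i (1 : ℝ)

/-- Rotation by +90°; produces the right-handed unit tangent `τ = (-ν₂, ν₁)`
from the outer normal `ν`. -/
def rot (v : E2) : E2 := ⟪v, e 0⟫ • e 1 - ⟪v, e 1⟫ • e 0

/-- The uniform ball condition (UBC) with radius `r`: at every boundary point there are
an open interior ball and an open exterior ball of radius `r` whose boundary spheres
meet exactly at that point. -/
def IsUBCWith (Ω : Set E2) (r : ℝ) : Prop :=
  0 < r ∧ ∀ x ∈ frontier Ω, ∃ cIn cOut : E2,
    ball cIn r ⊆ Ω ∧ ball cOut r ⊆ Ωᶜ ∧ sphere cIn r ∩ sphere cOut r = {x}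

/-- A UBC domain: a bounded domain satisfying the UBC for some radius. -/
def IsUBCDomain (Ω : Set E2) : Prop :=
  IsOpen Ω ∧ IsConnected Ω ∧ Bornology.IsBounded Ω ∧ ∃ r : ℝ, IsUBCWith Ω r

/-- The maximal UBC radius `r_Ω`. -/
def ubcRadius (Ω : Set E2) : ℝ := sSup {r : ℝ | IsUBCWith Ω r}

/-- The perimeter `P(Ω) = H¹(∂Ω)`. -/
def perim (Ω : Set E2) : ℝ := (μH[1] (frontier Ω)).toReal

/-- The area `|Ω|`. -/
def area (Ω : Set E2) : ℝ := (volume Ω).toReal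

/-- Boundary integral with respect to the 1-dimensional Hausdorff measure. -/
def bInt (Ω : Set E2) (f : E2 → ℝ) : ℝ := ∫ x in frontier Ω, f x ∂μH[1]

open Classical in
/-- The signed distance function `d_Ω` (negative inside `Ω`). -/
def sdist (Ω : Set E2) (x : E2) : ℝ :=
  if x ∈ Ω then -(infDist x (frontier Ω)) else infDist x Ω

/-- The tubular neighborhood `N_r(∂Ω)`. -/
def tubNbhd (Ω : Set E2) (r : ℝ) : Set E2 := {x : E2 | infDist x (frontier Ω) < r}

/-- Pointwise vector Laplacian. -/
def vLap (u : E2 → E2) (x : E2) : E2 :=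
  ∑ i : Fin 2, fderiv ℝ (fderiv ℝ u) x (e i) (e i)

/-- Pointwise gradient of a scalar function. -/
def gradv (f : E2 → ℝ) (x : E2) : E2 := ∑ i : Fin 2, fderiv ℝ f x (e i) • e i

/-- Pointwise divergence of a vector field. -/
def divg (u : E2 → E2) (x : E2) : ℝ := ∑ i : Fin 2, ⟪fderiv ℝ u x (e i), e i⟫

/-- The entry `(∇u)_{ij} = ∂_j u_i` of the gradient matrix. -/
def gradEntry (u : E2 → E2) (x : E2) (i j : Fin 2) : ℝ := ⟪fderiv ℝ u x (e j), e i⟫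

/-- The entry of the symmetric gradient `∇_sym u = (∇u + (∇u)ᵀ)/2`. -/
def symGradEntry (u : E2 → E2) (x : E2) (i j : Fin 2) : ℝ :=
  (gradEntry u x i j + gradEntry u x j i) / 2

/-- The symmetric gradient applied to a vector. -/
def symGradApp (u : E2 → E2) (x v : E2) : E2 :=
  ∑ i : Fin 2, (∑ j : Fin 2, symGradEntry u x i j * ⟪v, e j⟫) • e i

/-- Squared Frobenius norm `|∇u|²`. -/
def gradNormSq (u : E2 → E2) (x : E2) : ℝ :=
  ∑ i : Fin 2, ∑ j : Fin 2, (gradEntry u x i j)^2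

/-- Squared Frobenius norm `|∇_sym u|²`. -/
def symGradNormSq (u : E2 → E2) (x : E2) : ℝ :=
  ∑ i : Fin 2, ∑ j : Fin 2, (symGradEntry u x i j)^2

/-- `ν` is the outer unit normal of `Ω` at the boundary point `x`, characterized via the
interior and exterior tangent balls of the uniform ball condition. -/
def IsOuterNormalAt (Ω : Set E2) (x ν : E2) : Prop :=
  ‖ν‖ = 1 ∧ ∀ r : ℝ, IsUBCWith Ω r →
    ball (x - r • ν) r ⊆ Ω ∧ ball (x + r • ν) r ⊆ Ωᶜ

/-- `∫_Ω |∇^k u|² dx`. -/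
def derivSq (k : ℕ) (Ω : Set E2) (u : E2 → E2) : ℝ :=
  ∫ x in Ω, ‖iteratedFDeriv ℝ k u x‖^2

/-- Squared Sobolev norm `‖u‖²_{H^n(Ω)}`. -/
def hSobSq (n : ℕ) (Ω : Set E2) (u : E2 → E2) : ℝ :=
  ∑ k ∈ Finset.range (n + 1), derivSq k Ω u


/-- A bounded `C²`-regular domain in the plane, presented with its outer unit normal
(admitting a `C¹` extension near the boundary) and its scalar curvature, related by
the Weingarten identity `κ = ⟨∂_τ ν, τ⟩`. -/
structure C2Domain where
  carrier : Set E2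
  nu : E2 → E2
  kappa : E2 → ℝ
  isOpen : IsOpen carrier
  isConnected : IsConnected carrier
  isBounded : Bornology.IsBounded carrier
  ubc : ∃ r : ℝ, IsUBCWith carrier r
  nu_reg : ∃ U : Set E2, IsOpen U ∧ frontier carrier ⊆ U ∧ ContDiffOn ℝ 1 nu U
  nu_normal : ∀ x ∈ frontier carrier, IsOuterNormalAt carrier x (nu x)
  kappa_eq : ∀ x ∈ frontier carrier,
    kappa x = ⟪fderiv ℝ nu x (rot (nu x)), rot (nu x)⟫

theorem nsq (v : E2) : ‖v‖ ^ 2 = v 0 ^ 2 + v 1 ^ 2 := by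
  simp [EuclideanSpace.norm_sq_eq, Fin.sum_univ_two]

theorem inn (v w : E2) : ⟪v, w⟫ = v 0 * w 0 + v 1 * w 1 := by
  simp [PiLp.inner_apply, Fin.sum_univ_two]; ring

theorem rot0 (v : E2) : rot v 0 = - v 1 := by
  simp [rot, e, inn]

theorem rot1 (v : E2) : rot v 1 = v 0 := by
  simp [rot, e, inn]

theorem norm_rot (v : E2) : ‖rot v‖ = ‖v‖ := by
  have : ‖rot v‖ ^ 2 = ‖v‖ ^ 2 := by rw [nsq, nsq, rot0, rot1]; ring
  exact (sq_eq_sq₀ (norm_nonneg _) (norm_nonneg _)).1 this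

theorem inner_rot (v : E2) : ⟪rot v, v⟫ = 0 := by
  rw [inn, rot0, rot1]; ring

theorem decomp (v d : E2) (hv : ‖v‖ = 1) : d = ⟪d, v⟫ • v + ⟪d, rot v⟫ • rot v := by
  have h := nsq v
  rw [hv] at h
  ext i
  fin_cases i
  · simp [inn, rot0, rot1]; linear_combination d 0 * h
  · simp [inn, rot0, rot1]; linear_combination d 1 * h

theorem exists_frontier {s Ω : Set E2} (hs : IsPreconnected s) (hΩ : IsOpen Ω)
    (h1 : (s ∩ Ω).Nonempty) (h2 : ¬ s ⊆ Ω) : ∃ z ∈ s, z ∈ frontier Ω := by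
  by_contra! hc
  apply h2
  apply hs.subset_of_closure_inter_subset hΩ h1
  rintro z ⟨hz, hzs⟩
  by_contra hzΩ
  exact hc z hzs (by rw [hΩ.frontier_eq]; exact ⟨hz, hzΩ⟩)

/-- Squared-norm identity for tangent balls. -/
theorem ball_id (x z n : E2) (r : ℝ) (hn : ‖n‖ = 1) :
    ‖z - (x - r • n)‖ ^ 2 = ‖z - x‖ ^ 2 + 2 * r * ⟪z - x, n⟫ + r ^ 2 := by
  have h := nsq n
  rw [hn] at h
  simp only [nsq, inn, PiLp.sub_apply, PiLp.smul_apply, smul_eq_mul]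
  linear_combination (-r ^ 2) * h

theorem ball_id' (x z n : E2) (r : ℝ) (hn : ‖n‖ = 1) :
    ‖z - (x + r • n)‖ ^ 2 = ‖z - x‖ ^ 2 - 2 * r * ⟪z - x, n⟫ + r ^ 2 := by
  have h := ball_id x z n (-r) hn
  rw [neg_smul, sub_neg_eq_add] at h
  rw [h]; ring

/-- The geometric package. -/
structure Pkg (F : Set E2) (N : E2 → E2) (R : ℝ) : Prop where
  pos : 0 < R
  cpt : IsCompact F
  ne : F.Nonempty
  unit : ∀ x ∈ F, ‖N x‖ = 1
  sep : ∀ x ∈ F, ∀ y ∈ F, 2 * R ≤ ‖(x - y) - R • (N x + N y)‖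
  tang : ∀ x ∈ F, ∀ y ∈ F, 2 * R * |⟪y - x, N x⟫| ≤ ‖y - x‖ ^ 2
  ex : ∀ x ∈ F, ∀ v : E2, ⟪v, N x⟫ = 0 → ‖v‖ < R →
    ∃ s : ℝ, |s| * R ≤ ‖v‖ ^ 2 ∧ x + v + s • N x ∈ F
  max : ∀ r, R < r → ∃ x ∈ F, ∃ y ∈ F, ‖y - x‖ ^ 2 < 2 * r * |⟪y - x, N x⟫|

theorem frontier_ne (D : C2Domain) : (frontier D.carrier).Nonempty := by
  rw [nonempty_frontier_iff]
  refine ⟨D.isConnected.nonempty, ?_⟩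
  intro h
  have := D.isBounded
  rw [h] at this
  exact NormedSpace.unbounded_univ ℝ E2 this

theorem ubc_bdd (D : C2Domain) : BddAbove {r : ℝ | IsUBCWith D.carrier r} := by
  obtain ⟨x, hx⟩ := frontier_ne D
  refine ⟨Metric.diam D.carrier, ?_⟩
  intro r hr
  have hr0 : 0 < r := hr.1
  obtain ⟨hn, h⟩ := D.nu_normal x hx
  have h1 := (h r hr).1
  have a : x - (r / 2) • D.nu x ∈ D.carrier := by
    apply h1
    rw [mem_ball, dist_eq_norm, show x - (r / 2) • D.nu x - (x - r • D.nu x) = (r / 2) • D.nu x by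
      module, norm_smul, hn, Real.norm_eq_abs, abs_of_pos (by linarith)]
    linarith
  have b : x - (3 * r / 2) • D.nu x ∈ D.carrier := by
    apply h1
    rw [mem_ball, dist_eq_norm, show x - (3 * r / 2) • D.nu x - (x - r • D.nu x)
      = (- (r / 2)) • D.nu x by module, norm_smul, hn, Real.norm_eq_abs, abs_neg,
      abs_of_pos (by linarith)]
    linarith
  have c := Metric.dist_le_diam_of_mem D.isBounded a b
  rw [dist_eq_norm, show x - (r / 2) • D.nu x - (x - (3 * r / 2) • D.nu x) = r • D.nu x by
      module, norm_smul, hn, Real.norm_eq_abs, abs_of_pos hr0] at c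
  linarith

theorem pkg (D : C2Domain) : Pkg (frontier D.carrier) D.nu (ubcRadius D.carrier) := by
  set R := ubcRadius D.carrier with hR
  obtain ⟨r0, hr0⟩ := D.ubc
  have hbdd := ubc_bdd D
  have hpos : 0 < R := lt_of_lt_of_le hr0.1 (le_csSup hbdd hr0)
  have hunit : ∀ x ∈ frontier D.carrier, ‖D.nu x‖ = 1 := fun x hx => (D.nu_normal x hx).1
  have happ : ∀ f : ℝ → E2, Continuous f → ‖f R‖ < R →
      ∃ r, IsUBCWith D.carrier r ∧ ‖f r‖ < r := by
    intro f hf h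
    have ho : IsOpen {r | ‖f r‖ < r} := isOpen_lt (by fun_prop) continuous_id
    obtain ⟨ε, hε, hb⟩ := Metric.isOpen_iff.1 ho R h
    obtain ⟨r, hr, hlt⟩ := exists_lt_of_lt_csSup (s := {r : ℝ | IsUBCWith D.carrier r})
      ⟨r0, hr0⟩ (b := R - ε) (by have : R = sSup {r : ℝ | IsUBCWith D.carrier r} := rfl
                                 linarith)
    refine ⟨r, hr, hb ?_⟩
    have : r ≤ R := le_csSup hbdd hr
    rw [mem_ball, Real.dist_eq, abs_lt]
    constructor <;> linarith
  have hin : ∀ x ∈ frontier D.carrier, ball (x - R • D.nu x) R ⊆ D.carrier := by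
    intro x hx z hz
    rw [mem_ball, dist_eq_norm] at hz
    obtain ⟨r, hr, h⟩ := happ (fun r => z - (x - r • D.nu x)) (by fun_prop) hz
    exact ((D.nu_normal x hx).2 r hr).1 (by rwa [mem_ball, dist_eq_norm])
  have hout : ∀ x ∈ frontier D.carrier, ball (x + R • D.nu x) R ⊆ D.carrierᶜ := by
    intro x hx z hz
    rw [mem_ball, dist_eq_norm] at hz
    obtain ⟨r, hr, h⟩ := happ (fun r => z - (x + r • D.nu x)) (by fun_prop) hz
    exact ((D.nu_normal x hx).2 r hr).2 (by rwa [mem_ball, dist_eq_norm])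
  have hcl : ∀ x ∈ frontier D.carrier, ∀ y ∈ frontier D.carrier, y ∉ ball (x + R • D.nu x) R := by
    intro x hx y hy hyb
    obtain ⟨z, hz, hz2⟩ := mem_closure_iff.1 (frontier_subset_closure hy) _ isOpen_ball hyb
    exact hout x hx hz hz2
  have hcl' : ∀ x ∈ frontier D.carrier, ∀ y ∈ frontier D.carrier, y ∉ ball (x - R • D.nu x) R := by
    intro x hx y hy hyb
    have := hin x hx hyb
    rw [D.isOpen.frontier_eq] at hy
    exact hy.2 this
  refine ⟨hpos, ?_, frontier_ne D, hunit, ?_, ?_, ?_, ?_⟩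
  · exact Metric.isCompact_of_isClosed_isBounded isClosed_frontier
      (D.isBounded.closure.subset frontier_subset_closure)
  · intro x hx y hy
    by_contra! hc
    set w := (x - y) - R • (D.nu x + D.nu y) with hw
    have h1 : (x - R • D.nu x) - (1 / 2 : ℝ) • w ∈ D.carrier := by
      apply hin x hx
      rw [mem_ball, dist_eq_norm, show x - R • D.nu x - (1 / 2 : ℝ) • w - (x - R • D.nu x)
        = -((1 / 2 : ℝ) • w) by abel, norm_neg, norm_smul, Real.norm_eq_abs, abs_of_pos (by norm_num)]
      linarith
    have h2 : (x - R • D.nu x) - (1 / 2 : ℝ) • w ∈ D.carrierᶜ := by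
      apply hout y hy
      rw [mem_ball, dist_eq_norm, show x - R • D.nu x - (1 / 2 : ℝ) • w - (y + R • D.nu y)
        = ((1 / 2 : ℝ) • w) by rw [hw]; module, norm_smul, Real.norm_eq_abs, abs_of_pos (by norm_num)]
      linarith
    exact h2 h1
  · intro x hx y hy
    have a := hcl x hx y hy
    have b := hcl' x hx y hy
    rw [mem_ball, dist_eq_norm, not_lt] at a b
    have a2 := pow_le_pow_left₀ hpos.le a 2
    have b2 := pow_le_pow_left₀ hpos.le b 2
    rw [ball_id' _ _ _ _ (hunit x hx)] at a2
    rw [ball_id _ _ _ _ (hunit x hx)] at b2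
    rcases abs_cases ⟪y - x, D.nu x⟫ with h | h <;> rw [h.1] <;> linarith
  · intro x hx v hv hvR
    by_cases hv0 : v = 0
    · exact ⟨0, by simp [hv0], by simpa [hv0] using hx⟩
    have hvp : 0 < ‖v‖ := norm_pos_iff.2 hv0
    set q := ‖v‖ ^ 2 / R with hq
    have hq0 : 0 < q := by positivity
    have hqR : q * R = ‖v‖ ^ 2 := by rw [hq]; field_simp
    have hqlt : q < R := by
      have : q * R < R * R := by rw [hqR]; nlinarith
      exact lt_of_mul_lt_mul_right this hpos.le
    have hvn : ∀ s : ℝ, ‖v + s • D.nu x‖ ^ 2 = ‖v‖ ^ 2 + s ^ 2 := by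
      intro s
      rw [norm_add_sq_real, inner_smul_right, hv, norm_smul, hunit x hx, mul_one, Real.norm_eq_abs,
        sq_abs]
      ring
    have key : ‖v + (R - q) • D.nu x‖ < R := by
      apply lt_of_pow_lt_pow_left₀ 2 hpos.le
      rw [hvn]
      nlinarith
    have key2 : ‖v + (-(R - q)) • D.nu x‖ < R := by
      apply lt_of_pow_lt_pow_left₀ 2 hpos.le
      rw [hvn]
      nlinarith
    have hpc : IsPreconnected ((fun s : ℝ => x + v + s • D.nu x) '' Set.Icc (-q) q) :=
      isPreconnected_Icc.image _ (by fun_prop)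
    have m1 : x + v + (-q) • D.nu x ∈ D.carrier := by
      apply hin x hx
      rw [mem_ball, dist_eq_norm]
      rw [show x + v + (-q) • D.nu x - (x - R • D.nu x) = v + (R - q) • D.nu x by module]
      exact key
    have m2 : x + v + q • D.nu x ∈ D.carrierᶜ := by
      apply hout x hx
      rw [mem_ball, dist_eq_norm]
      rw [show x + v + q • D.nu x - (x + R • D.nu x) = v + (-(R - q)) • D.nu x by module]
      exact key2
    obtain ⟨z, ⟨s, hs, rfl⟩, hz⟩ := exists_frontier hpc D.isOpen
      ⟨_, ⟨-q, ⟨le_refl _, by linarith⟩, rfl⟩, m1⟩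
      (fun h => m2 (h ⟨q, ⟨by linarith, le_refl _⟩, rfl⟩))
    refine ⟨s, ?_, hz⟩
    have := abs_le.2 hs
    rw [← hqR]
    gcongr
  · intro r hr
    have hr0 : 0 < r := hpos.trans hr
    by_contra! hc
    have : IsUBCWith D.carrier r := by
      refine ⟨hr0, fun x hx => ⟨x - r • D.nu x, x + r • D.nu x, ?_, ?_, ?_⟩⟩
      · by_contra hns
        obtain ⟨z, hz, hzf⟩ := exists_frontier (convex_ball _ _).isPreconnected D.isOpen
          ⟨x - R • D.nu x, by
            rw [mem_ball, dist_eq_norm, show x - R • D.nu x - (x - r • D.nu x)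
              = (r - R) • D.nu x by module, norm_smul, hunit x hx, Real.norm_eq_abs,
              abs_of_pos (by linarith)]
            linarith, hin x hx (mem_ball_self hpos)⟩ hns
        rw [mem_ball, dist_eq_norm] at hz
        have h2 := pow_lt_pow_left₀ hz (norm_nonneg _) two_ne_zero
        rw [ball_id _ _ _ _ (hunit x hx)] at h2
        have h3 := hc x hx z hzf
        have h4 := neg_abs_le ⟪z - x, D.nu x⟫
        nlinarith
      · by_contra hns
        have hex : ∃ z ∈ ball (x + r • D.nu x) r, z ∈ frontier D.carrier := by
          by_contra hcon
          apply hcon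
          apply exists_frontier (convex_ball _ _).isPreconnected D.isOpen
          · obtain ⟨z, hz, hz2⟩ := Set.not_subset.1 hns
            exact ⟨z, hz, not_not.1 hz2⟩
          · intro hsub
            apply hout x hx (mem_ball_self hpos)
            apply hsub
            rw [mem_ball, dist_eq_norm, show x + R • D.nu x - (x + r • D.nu x)
              = (-(r - R)) • D.nu x by module, norm_smul, hunit x hx, Real.norm_eq_abs, abs_neg,
              abs_of_pos (by linarith)]
            linarith
        obtain ⟨z, hz, hzf⟩ := hex
        rw [mem_ball, dist_eq_norm] at hz
        have h2 := pow_lt_pow_left₀ hz (norm_nonneg _) two_ne_zero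
        rw [ball_id' _ _ _ _ (hunit x hx)] at h2
        have h3 := hc x hx z hzf
        have h4 := le_abs_self ⟪z - x, D.nu x⟫
        nlinarith
      · ext z
        simp only [mem_inter_iff, mem_sphere, dist_eq_norm, mem_singleton_iff]
        constructor
        · rintro ⟨h1, h2⟩
          have e1 := ball_id x z _ r (hunit x hx)
          have e2 := ball_id' x z _ r (hunit x hx)
          rw [h1] at e1
          rw [h2] at e2
          have : ‖z - x‖ ^ 2 = 0 := by linarith
          rwa [sq_eq_zero_iff, norm_eq_zero, sub_eq_zero] at this
        · rintro rfl
          constructor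
          · rw [sub_sub_cancel, norm_smul, hunit _ hx, Real.norm_eq_abs, abs_of_pos hr0, mul_one]
          · rw [sub_add_cancel_left, norm_neg, norm_smul, hunit _ hx, Real.norm_eq_abs,
              abs_of_pos hr0, mul_one]
    have h := le_csSup hbdd this
    change r ≤ R at h
    linarith

theorem Pkg.lip {F : Set E2} {N : E2 → E2} {R : ℝ} (P : Pkg F N R) {x y : E2} (hx : x ∈ F)
    (hy : y ∈ F) : ‖N x - N y‖ * R ≤ ‖x - y‖ := by
  have hpos := P.pos
  have h1 := pow_le_pow_left₀ (by linarith) (P.sep x hx y hy) 2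
  have h2 := pow_le_pow_left₀ (by linarith) (P.sep y hy x hx) 2
  have n1 := nsq (N x)
  have n2 := nsq (N y)
  rw [P.unit x hx] at n1
  rw [P.unit y hy] at n2
  refine (pow_le_pow_iff_left₀ (mul_nonneg (norm_nonneg _) hpos.le) (norm_nonneg _) two_ne_zero).1 ?_
  rw [mul_pow]
  simp only [nsq, PiLp.sub_apply, PiLp.add_apply, PiLp.smul_apply, smul_eq_mul] at h1 h2 ⊢
  have n1' := congrArg (fun z => z * R ^ 2) n1
  have n2' := congrArg (fun z => z * R ^ 2) n2
  simp only at n1' n2'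
  linarith

theorem Pkg.seq {F : Set E2} {N : E2 → E2} {R : ℝ} (P : Pkg F N R) {x : E2} (hx : x ∈ F)
    {A : E2 →L[ℝ] E2} (hA : HasFDerivAt N A x) {τ : E2} (hτ : ‖τ‖ = 1) (hτN : ⟪τ, N x⟫ = 0) :
    ∃ (t : ℕ → ℝ) (u w : ℕ → E2), (∀ n, 0 < t n) ∧ Tendsto t atTop (𝓝 0) ∧
      Tendsto u atTop (𝓝 τ) ∧ Tendsto w atTop (𝓝 (A τ)) ∧
      (∀ n, x + t n • u n ∈ F) ∧ (∀ n, N (x + t n • u n) = N x + t n • w n) := by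
  have hpos := P.pos
  set t : ℕ → ℝ := fun n => R * (1 / ((n + 1 : ℕ) + 1)) with ht
  have ht0 : ∀ n, 0 < t n := fun n => by simp only [ht]; positivity
  have htR : ∀ n, t n < R := fun n => by
    simp only [ht]
    have : (1 / (((n + 1 : ℕ) : ℝ) + 1)) < 1 := by
      rw [div_lt_one (by positivity)]; push_cast; linarith [(Nat.cast_nonneg n : (0 : ℝ) ≤ n)]
    nlinarith
  have htl : Tendsto t atTop (𝓝 0) := by
    have := (tendsto_one_div_add_atTop_nhds_zero_nat (𝕜 := ℝ)).comp (tendsto_add_atTop_nat 1)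
    simpa [ht, Function.comp_def] using this.const_mul R
  have hex : ∀ n, ∃ s : ℝ, |s| * R ≤ ‖t n • τ‖ ^ 2 ∧ x + t n • τ + s • N x ∈ F := fun n =>
    P.ex x hx (t n • τ) (by rw [inner_smul_left, hτN, mul_zero])
      (by rw [norm_smul, hτ, mul_one, Real.norm_eq_abs, abs_of_pos (ht0 n)]; exact htR n)
  choose s hs hsF using hex
  have hs' : ∀ n, |s n / t n| ≤ t n / R := by
    intro n
    have h := hs n
    rw [norm_smul, hτ, mul_one, Real.norm_eq_abs, abs_of_pos (ht0 n)] at h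
    rw [abs_div, abs_of_pos (ht0 n), div_le_div_iff₀ (ht0 n) hpos]
    linarith
  have hsl : Tendsto (fun n => s n / t n) atTop (𝓝 0) := by
    apply squeeze_zero_norm hs'
    simpa using htl.div_const R
  set u : ℕ → E2 := fun n => τ + (s n / t n) • N x with hu
  have hul : Tendsto u atTop (𝓝 τ) := by
    simpa using (tendsto_const_nhds (x := τ)).add (hsl.smul_const (N x))
  have htu : ∀ n, t n • u n = t n • τ + s n • N x := fun n => by
    simp only [hu, smul_add, smul_smul]
    rw [mul_div_cancel₀ _ (ht0 n).ne']
  have hd : Tendsto (fun n => t n • u n) atTop (𝓝 0) := by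
    simpa using htl.smul hul
  refine ⟨t, u, fun n => (t n)⁻¹ • (N (x + t n • u n) - N x), ht0, htl, hul, ?_, ?_, ?_⟩
  · apply (hasFDerivWithinAt_univ.2 hA).lim hd (.of_forall fun _ => mem_univ _)
    refine hul.congr fun n => ?_
    rw [smul_smul, inv_mul_cancel₀ (ht0 n).ne', one_smul]
  · intro n
    rw [htu, ← add_assoc]
    exact hsF n
  · intro n
    rw [smul_smul, mul_inv_cancel₀ (ht0 n).ne', one_smul, add_sub_cancel]

theorem Pkg.deriv_norm {F : Set E2} {N : E2 → E2} {R : ℝ} (P : Pkg F N R) {x : E2} (hx : x ∈ F)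
    {A : E2 →L[ℝ] E2} (hA : HasFDerivAt N A x) {τ : E2} (hτ : ‖τ‖ = 1) (hτN : ⟪τ, N x⟫ = 0) :
    ‖A τ‖ * R ≤ 1 := by
  obtain ⟨t, u, w, ht, htl, hu, hw, hF, hN⟩ := P.seq hx hA hτ hτN
  rw [← hτ]
  refine le_of_tendsto_of_tendsto' (hw.norm.mul_const R) hu.norm fun n => ?_
  have h := P.lip (hF n) hx
  rw [hN, add_sub_cancel_left, add_sub_cancel_left, norm_smul, norm_smul, Real.norm_eq_abs,
    abs_of_pos (ht n), mul_assoc] at h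
  exact le_of_mul_le_mul_left h (ht n)

theorem Pkg.deriv_orth {F : Set E2} {N : E2 → E2} {R : ℝ} (P : Pkg F N R) {x : E2} (hx : x ∈ F)
    {A : E2 →L[ℝ] E2} (hA : HasFDerivAt N A x) {τ : E2} (hτ : ‖τ‖ = 1) (hτN : ⟪τ, N x⟫ = 0) :
    ⟪A τ, N x⟫ = 0 := by
  obtain ⟨t, u, w, ht, htl, hu, hw, hF, hN⟩ := P.seq hx hA hτ hτN
  have h1 : Tendsto (fun n => 2 * ⟪w n, N x⟫ + t n * ‖w n‖ ^ 2) atTop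
      (𝓝 (2 * ⟪A τ, N x⟫ + 0 * ‖A τ‖ ^ 2)) :=
    ((hw.inner tendsto_const_nhds).const_mul 2).add (htl.mul (hw.norm.pow 2))
  have h2 : (fun n => 2 * ⟪w n, N x⟫ + t n * ‖w n‖ ^ 2) = fun _ => (0 : ℝ) := by
    funext n
    have h := P.unit _ (hF n)
    have h' := P.unit _ hx
    have h3 := norm_add_sq_real (N x) (t n • w n)
    rw [← hN, h, h', inner_smul_right, norm_smul, Real.norm_eq_abs, abs_of_pos (ht n),
      real_inner_comm] at h3
    have : t n * (2 * ⟪w n, N x⟫ + t n * ‖w n‖ ^ 2) = 0 := by linarith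
    exact (mul_eq_zero.1 this).resolve_left (ht n).ne'
  rw [h2] at h1
  have := tendsto_nhds_unique h1 tendsto_const_nhds
  linarith

theorem Pkg.deriv_pair {F : Set E2} {N : E2 → E2} {R : ℝ} (P : Pkg F N R) {x y : E2} (hx : x ∈ F)
    (hy : y ∈ F)
    {A : E2 →L[ℝ] E2} (hA : HasFDerivAt N A x) {τ : E2} (hτ : ‖τ‖ = 1) (hτN : ⟪τ, N x⟫ = 0)
    (heq : ‖x - y‖ ^ 2 = R ^ 2 * ‖N x - N y‖ ^ 2) :
    0 ≤ ⟪x - y, τ⟫ - R ^ 2 * ⟪N x - N y, A τ⟫ := by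
  obtain ⟨t, u, w, ht, htl, hu, hw, hF, hN⟩ := P.seq hx hA hτ hτN
  have h1 : Tendsto (fun n => 2 * ⟪x - y, u n⟫ + t n * ‖u n‖ ^ 2
      - R ^ 2 * (2 * ⟪N x - N y, w n⟫ + t n * ‖w n‖ ^ 2)) atTop
      (𝓝 (2 * ⟪x - y, τ⟫ + 0 * ‖τ‖ ^ 2 - R ^ 2 * (2 * ⟪N x - N y, A τ⟫ + 0 * ‖A τ‖ ^ 2))) :=
    (((tendsto_const_nhds.inner hu).const_mul 2).add (htl.mul (hu.norm.pow 2))).sub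
    ((((tendsto_const_nhds.inner hw).const_mul 2).add (htl.mul (hw.norm.pow 2))).const_mul _)
  have h2 := ge_of_tendsto' h1 (b := 0) fun n => by
    have h := P.lip (hF n) hy
    have h' := pow_le_pow_left₀ (mul_nonneg (norm_nonneg _) P.pos.le) h 2
    rw [hN, show N x + t n • w n - N y = (N x - N y) + t n • w n by abel,
      show x + t n • u n - y = (x - y) + t n • u n by abel, mul_pow, norm_add_sq_real,
      norm_add_sq_real, inner_smul_right, inner_smul_right, norm_smul, norm_smul,
      Real.norm_eq_abs, abs_of_pos (ht n), heq] at h'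
    have : 0 ≤ t n * (2 * ⟪x - y, u n⟫ + t n * ‖u n‖ ^ 2
      - R ^ 2 * (2 * ⟪N x - N y, w n⟫ + t n * ‖w n‖ ^ 2)) := by linarith
    exact nonneg_of_mul_nonneg_right this (ht n)
  linarith

theorem Pkg.contact_core {F : Set E2} {N : E2 → E2} {R : ℝ} (P : Pkg F N R) {x y : E2}
    (hx : x ∈ F) (hy : y ∈ F) (hxy : x ≠ y) {A : E2 →L[ℝ] E2} (hA : HasFDerivAt N A x) {k : ℝ}
    (hk : A (rot (N x)) = k • rot (N x)) (hkR : |k| * R < 1) (σ : ℝ) (hσ : σ ^ 2 = 1)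
    (h : 2 * R * (σ * ⟪y - x, N x⟫) = ‖y - x‖ ^ 2)
    (hsep : (2 * R) ^ 2 ≤ ‖(y - x) - (σ * R) • (N x + N y)‖ ^ 2) :
    y = x + (σ * (2 * R)) • N x ∧ N x = -N y := by
  have hpos := P.pos
  have hux := P.unit x hx
  have huy := P.unit y hy
  have nx := nsq (N x)
  have ny := nsq (N y)
  rw [hux] at nx
  rw [huy] at ny
  -- common centre
  have hz : ‖(y + (σ * R) • N y) - (x + (σ * R) • N x)‖ ^ 2 ≤ 0 := by
    simp only [nsq, inn, PiLp.sub_apply, PiLp.add_apply, PiLp.smul_apply, smul_eq_mul] at h hsep ⊢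
    have e1 := congrArg (fun z => z * (σ ^ 2 * R ^ 2)) nx
    have e2 := congrArg (fun z => z * (σ ^ 2 * R ^ 2)) ny
    have e3 := congrArg (fun z => z * R ^ 2) hσ
    simp only at e1 e2 e3
    nlinarith
  have hc : (y + (σ * R) • N y) = (x + (σ * R) • N x) := by
    rw [← sub_eq_zero, ← norm_eq_zero, ← sq_eq_zero_iff]
    exact le_antisymm hz (sq_nonneg _)
  have hd : x - y = (-(σ * R)) • (N x - N y) := by
    have : x - y = (σ * R) • N y - (σ * R) • N x := by
      rw [sub_eq_sub_iff_add_eq_add, ← hc, add_comm]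
    rw [this]; module
  have hd2 : N x - N y = (-(σ / R)) • (x - y) := by
    rw [hd, smul_smul, show -(σ / R) * -(σ * R) = σ ^ 2 by field_simp, hσ, one_smul]
  have heq : ‖x - y‖ ^ 2 = R ^ 2 * ‖N x - N y‖ ^ 2 := by
    rw [hd, norm_smul, mul_pow, Real.norm_eq_abs, sq_abs, neg_sq, mul_pow, hσ, one_mul]
  have hτ : ‖rot (N x)‖ = 1 := by rw [norm_rot, hux]
  have hτN := inner_rot (N x)
  have d1 := P.deriv_pair hx hy hA hτ hτN heq
  have d2 := P.deriv_pair hx hy hA (τ := -rot (N x)) (by rw [norm_neg, hτ])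
    (by rw [inner_neg_left, hτN, neg_zero]) heq
  rw [map_neg, inner_neg_right, inner_neg_right] at d2
  have d3 : ⟪x - y, rot (N x)⟫ - R ^ 2 * ⟪N x - N y, A (rot (N x))⟫ = 0 := by linarith
  rw [hk, hd2, inner_smul_left, inner_smul_right] at d3
  have d4 : (1 + σ * R * k) * ⟪x - y, rot (N x)⟫ = 0 := by
    rw [← d3]; simp; field_simp
  have hne : 1 + σ * R * k ≠ 0 := by
    intro h0
    have h1 : (σ * R * k) ^ 2 = 1 := by
      rw [show σ * R * k = -1 by linarith]; norm_num
    have h2 : (|k| * R) ^ 2 = 1 := by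
      rw [mul_pow, sq_abs, ← h1, mul_pow, mul_pow, hσ]; ring
    have h3 : 0 ≤ |k| * R := by positivity
    nlinarith
  have d5 := (mul_eq_zero.1 d4).resolve_left hne
  have d6 := decomp (N x) (y - x) hux
  have d7 : ⟪y - x, rot (N x)⟫ = 0 := by
    rw [← neg_sub, inner_neg_left, d5, neg_zero]
  rw [d7, zero_smul, add_zero] at d6
  set s := ⟪y - x, N x⟫ with hs
  have hn : ‖y - x‖ ^ 2 = s ^ 2 := by
    rw [d6, norm_smul, hux, mul_one, Real.norm_eq_abs, sq_abs]
  have hs0 : s ≠ 0 := by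
    intro h0
    rw [h0, zero_smul, sub_eq_zero] at d6
    exact hxy d6.symm
  have hs1 : s = σ * (2 * R) := by
    rw [hn] at h
    have : s * (s - σ * (2 * R)) = 0 := by linarith
    have := (mul_eq_zero.1 this).resolve_left hs0
    linarith
  refine ⟨by rw [← hs1, ← d6]; abel, ?_⟩
  have : N x - N y = (2 : ℝ) • N x := by
    rw [hd2, ← neg_sub, d6, hs1, ← neg_smul, smul_smul]
    congr 1
    field_simp
    rw [hσ]
  rw [two_smul] at this
  have h9 := sub_eq_iff_eq_add.1 this
  rw [add_assoc] at h9
  have h10 : N x + N y = 0 := by simpa using h9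
  exact eq_neg_of_add_eq_zero_left h10

theorem Pkg.contact {F : Set E2} {N : E2 → E2} {R : ℝ} (P : Pkg F N R) {x y : E2}
    (hx : x ∈ F) (hy : y ∈ F) (hxy : x ≠ y) {A : E2 →L[ℝ] E2} (hA : HasFDerivAt N A x) {k : ℝ}
    (hk : A (rot (N x)) = k • rot (N x)) (hkR : |k| * R < 1)
    (h : ‖y - x‖ ^ 2 ≤ 2 * R * |⟪y - x, N x⟫|) :
    (y = x + (2 * R) • N x ∨ y = x - (2 * R) • N x) ∧ N x = -N y := by
  have h' := le_antisymm (P.tang x hx y hy) h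
  have hpos := P.pos
  rcases abs_cases ⟪y - x, N x⟫ with hh | hh
  · rw [hh.1] at h'
    have := P.contact_core hx hy hxy hA hk hkR 1 (by norm_num) (by rw [one_mul]; exact h') (by
      have := pow_le_pow_left₀ (by linarith) (P.sep y hy x hx) 2
      rwa [one_mul, add_comm (N x)])
    rw [one_mul] at this
    exact ⟨Or.inl this.1, this.2⟩
  · rw [hh.1] at h'
    have := P.contact_core hx hy hxy hA hk hkR (-1) (by norm_num) (by rw [neg_one_mul]; exact h') (by
      have := pow_le_pow_left₀ (by linarith) (P.sep x hx y hy) 2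
      rw [← norm_neg, show -(y - x - (-1 * R) • (N x + N y)) = x - y - R • (N x + N y) by module]
      exact this)
    rw [neg_one_mul, neg_smul, ← sub_eq_add_neg] at this
    exact ⟨Or.inr this.1, this.2⟩

theorem Pkg.locLip {F : Set E2} {N : E2 → E2} {R : ℝ} (P : Pkg F N R) {x₀ : E2}
    (hx₀ : x₀ ∈ F) {A : E2 →L[ℝ] E2} (hA : HasStrictFDerivAt N A x₀) {k : ℝ}
    (hk : A (rot (N x₀)) = k • rot (N x₀)) (hkR : |k| * R < 1) :
    ∃ L : ℝ, 0 ≤ L ∧ L * R < 1 ∧ ∃ δ > 0, ∀ x ∈ F, ∀ y ∈ F, ‖x - x₀‖ < δ → ‖y - x₀‖ < δ →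
      ‖N y - N x‖ ≤ L * ‖y - x‖ := by
  have hpos := P.pos
  set ε := (1 / R - |k|) / 2 with hε
  have hkR' : |k| < 1 / R := by rwa [lt_div_iff₀ hpos]
  have hε0 : 0 < ε := by rw [hε]; linarith
  have hb := hA.isLittleO.bound (half_pos hε0)
  rw [Metric.eventually_nhds_iff] at hb
  obtain ⟨δ₁, hδ₁, hb⟩ := hb
  have hA0 : 0 ≤ ‖A‖ := norm_nonneg _
  set δ₂ := ε * R / (4 * (‖A‖ + 1)) with hδ₂
  have hδ₂0 : 0 < δ₂ := by positivity
  refine ⟨|k| + ε, by positivity, ?_, min δ₁ δ₂, lt_min hδ₁ hδ₂0, ?_⟩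
  · rw [← lt_div_iff₀ hpos, hε]; linarith
  intro x hx y hy hxd hyd
  have h1 := @hb (y, x) (by
    rw [Prod.dist_eq, max_lt_iff, dist_eq_norm, dist_eq_norm]
    exact ⟨hyd.trans_le (min_le_left _ _), hxd.trans_le (min_le_left _ _)⟩)
  simp only at h1
  have hxd2 := hxd.trans_le (min_le_right _ _)
  have hyd2 := hyd.trans_le (min_le_right _ _)
  set d := y - x with hd
  have hdn : ‖d‖ ≤ 2 * δ₂ := by
    have : d = (y - x₀) - (x - x₀) := by rw [hd]; abel
    rw [this]
    refine (norm_sub_le _ _).trans ?_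
    linarith
  have hin : |⟪d, N x₀⟫| ≤ ‖d‖ * (2 * δ₂ / R) := by
    have e1 : ⟪d, N x₀⟫ = ⟪d, N x⟫ + ⟪d, N x₀ - N x⟫ := by rw [inner_sub_right]; ring
    have e2 := P.tang x hx y hy
    have e3 := abs_real_inner_le_norm d (N x₀ - N x)
    have e4 := P.lip hx₀ hx
    rw [← norm_neg (x₀ - x), neg_sub] at e4
    have e5 := abs_add_le ⟪d, N x⟫ ⟪d, N x₀ - N x⟫
    rw [← e1] at e5
    rw [← hd] at e2
    have e6 : ‖d‖ * ‖N x₀ - N x‖ * R ≤ ‖d‖ * δ₂ := by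
      rw [mul_assoc]; exact mul_le_mul_of_nonneg_left (e4.trans hxd2.le) (norm_nonneg _)
    have e7 : ‖d‖ ^ 2 ≤ ‖d‖ * (2 * δ₂) := by
      rw [sq]; exact mul_le_mul_of_nonneg_left hdn (norm_nonneg _)
    rw [← mul_div_assoc, le_div_iff₀ hpos]
    nlinarith
  have hAd : ‖A d‖ ≤ (ε / 2) * ‖d‖ + |k| * ‖d‖ := by
    have hu := P.unit x₀ hx₀
    have e1 := decomp (N x₀) d hu
    have e2 : A d = ⟪d, N x₀⟫ • A (N x₀) + ⟪d, rot (N x₀)⟫ • (k • rot (N x₀)) := by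
      conv_lhs => rw [e1]
      rw [map_add, map_smul, map_smul, hk]
    rw [e2]
    refine (norm_add_le _ _).trans (add_le_add ?_ ?_)
    · rw [norm_smul, Real.norm_eq_abs]
      have a1 : ‖A (N x₀)‖ ≤ ‖A‖ := by
        have := A.le_opNorm (N x₀); rwa [hu, mul_one] at this
      calc |⟪d, N x₀⟫| * ‖A (N x₀)‖ ≤ ‖d‖ * (2 * δ₂ / R) * (‖A‖ + 1) := by
            gcongr; linarith
        _ = (ε / 2) * ‖d‖ := by
            rw [hδ₂]; field_simp; norm_num
    · rw [norm_smul, norm_smul, norm_rot, hu, mul_one, Real.norm_eq_abs, Real.norm_eq_abs, mul_comm]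
      gcongr
      have := abs_real_inner_le_norm d (rot (N x₀))
      rwa [norm_rot, hu, mul_one] at this
  have : N y - N x = (N y - N x - A d) + A d := by abel
  rw [this]
  refine (norm_add_le _ _).trans ?_
  linarith

theorem Pkg.mid {F : Set E2} {N : E2 → E2} {R : ℝ} (P : Pkg F N R) {x y : E2}
    (hx : x ∈ F) (hy : y ∈ F) (hq : ‖y - x‖ < R) :
    ∃ m ∈ F, ‖m - x‖ ≤ ‖y - x‖ / 2 + ‖y - x‖ ^ 2 / R ∧
      ‖y - m‖ ≤ ‖y - x‖ / 2 + ‖y - x‖ ^ 2 / R := by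
  have hpos := P.pos
  have hu := P.unit x hx
  have ht := P.tang x hx y hy
  set d := y - x with hd
  set a := ⟪d, N x⟫ with ha
  set v : E2 := (1 / 2 : ℝ) • (d - a • N x) with hv
  have hvN : ⟪v, N x⟫ = 0 := by
    rw [hv, inner_smul_left, inner_sub_left, inner_smul_left, real_inner_self_eq_norm_sq, hu, ← ha]
    simp
  have hvn : ‖v‖ ^ 2 ≤ ‖d‖ ^ 2 / 4 := by
    have : ‖v‖ ^ 2 = (‖d‖ ^ 2 - a ^ 2) / 4 := by
      rw [hv, norm_smul, mul_pow, norm_sub_sq_real, inner_smul_right, norm_smul, hu, ← ha, mul_one,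
        Real.norm_eq_abs, Real.norm_eq_abs, sq_abs, sq_abs]
      ring
    rw [this]; nlinarith [sq_nonneg a]
  obtain ⟨s, hs, hm⟩ := P.ex x hx v hvN (by
    refine lt_of_pow_lt_pow_left₀ 2 hpos.le ?_
    nlinarith [norm_nonneg d])
  have hsa : |s| + |a| / 2 ≤ ‖d‖ ^ 2 / R := by
    rw [le_div_iff₀ hpos]; nlinarith [sq_nonneg ‖d‖]
  refine ⟨_, hm, ?_, ?_⟩
  · rw [show x + v + s • N x - x = (1 / 2 : ℝ) • d + (s - a / 2) • N x by rw [hv]; module]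
    refine (norm_add_le _ _).trans ?_
    rw [norm_smul, norm_smul, hu, mul_one, Real.norm_eq_abs, Real.norm_eq_abs,
      abs_of_pos (by norm_num : (0 : ℝ) < 1 / 2)]
    have := abs_sub s (a / 2)
    rw [abs_div, abs_two] at this
    linarith
  · rw [show y - (x + v + s • N x) = (1 / 2 : ℝ) • d - (s - a / 2) • N x by rw [hv, hd]; module]
    refine (norm_sub_le _ _).trans ?_
    rw [norm_smul, norm_smul, hu, mul_one, Real.norm_eq_abs, Real.norm_eq_abs,
      abs_of_pos (by norm_num : (0 : ℝ) < 1 / 2)]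
    have := abs_sub s (a / 2)
    rw [abs_div, abs_two] at this
    linarith

theorem Pkg.improved {F : Set E2} {N : E2 → E2} {R : ℝ} (P : Pkg F N R) {x₀ : E2}
    {L δ : ℝ} (hL : 0 ≤ L)
    (h : ∀ x ∈ F, ∀ y ∈ F, ‖x - x₀‖ < δ → ‖y - x₀‖ < δ → ‖N y - N x‖ ≤ L * ‖y - x‖)
    {x y : E2} (hx : x ∈ F) (hy : y ∈ F) (hxd : ‖x - x₀‖ < δ / 4) (hyd : ‖y - x₀‖ < δ / 4)
    (hq : ‖y - x‖ < R) :
    |⟪y - x, N x⟫| ≤ (1 / R + L) * (‖y - x‖ / 2 + ‖y - x‖ ^ 2 / R) ^ 2 := by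
  have hpos := P.pos
  obtain ⟨m, hm, h1, h2⟩ := P.mid hx hy hq
  set B := ‖y - x‖ / 2 + ‖y - x‖ ^ 2 / R with hB
  have hB0 : 0 ≤ B := by positivity
  have hqd : ‖y - x‖ < δ / 2 := by
    rw [show y - x = (y - x₀) - (x - x₀) by abel]
    exact (norm_sub_le _ _).trans_lt (by linarith)
  have hBq : B ≤ 3 / 2 * ‖y - x‖ := by
    have : ‖y - x‖ ^ 2 / R ≤ ‖y - x‖ := by
      rw [div_le_iff₀ hpos, sq]; gcongr
    rw [hB]; linarith
  have hmd : ‖m - x₀‖ < δ := by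
    rw [show m - x₀ = (m - x) + (x - x₀) by abel]
    exact (norm_add_le _ _).trans_lt (by linarith)
  have hδ : 0 < δ := by linarith [norm_nonneg (x - x₀)]
  have hN := h m hm x hx hmd (by linarith)
  have e1 : ⟪y - x, N x⟫ = ⟪y - m, N m⟫ + ⟪y - m, N x - N m⟫ + ⟪m - x, N x⟫ := by
    simp only [inner_sub_left, inner_sub_right]; ring
  have t1 := P.tang m hm y hy
  have t2 := P.tang x hx m hm
  have t3 := abs_real_inner_le_norm (y - m) (N x - N m)
  have s1 : |⟪y - m, N m⟫| ≤ B ^ 2 / (2 * R) := by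
    rw [le_div_iff₀ (by positivity), mul_comm]
    exact t1.trans (pow_le_pow_left₀ (norm_nonneg _) h2 2)
  have s2 : |⟪m - x, N x⟫| ≤ B ^ 2 / (2 * R) := by
    rw [le_div_iff₀ (by positivity), mul_comm]
    exact t2.trans (pow_le_pow_left₀ (norm_nonneg _) h1 2)
  have s3 : |⟪y - m, N x - N m⟫| ≤ L * B ^ 2 := by
    rw [norm_sub_rev x m] at hN
    calc _ ≤ ‖y - m‖ * ‖N x - N m‖ := t3
      _ ≤ B * (L * B) := by
        gcongr
        exact hN.trans (by gcongr)
      _ = _ := by ring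
  rw [e1]
  have u1 := abs_add_le (⟪y - m, N m⟫ + ⟪y - m, N x - N m⟫) ⟪m - x, N x⟫
  have u2 := abs_add_le ⟪y - m, N m⟫ ⟪y - m, N x - N m⟫
  have : (1 / R + L) * B ^ 2 = B ^ 2 / (2 * R) + L * B ^ 2 + B ^ 2 / (2 * R) := by
    field_simp; ring
  linarith

theorem Pkg.main {F : Set E2} {N : E2 → E2} {R : ℝ} (P : Pkg F N R) {A : E2 → E2 →L[ℝ] E2}
    {k : E2 → ℝ} (hA : ∀ x ∈ F, HasStrictFDerivAt N (A x) x)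
    (hk : ∀ x ∈ F, A x (rot (N x)) = k x • rot (N x)) (hkR : ∀ x ∈ F, |k x| * R < 1) :
    ∃ x ∈ F, ∃ y ∈ F, (y = x + (2 * R) • N x ∨ y = x - (2 * R) • N x) ∧ N x = -N y := by
  have hpos := P.pos
  have hmax := fun n : ℕ => P.max (R + 1 / ((n : ℝ) + 1)) (by
    have : (0 : ℝ) < 1 / ((n : ℝ) + 1) := by positivity
    linarith)
  choose X hX Y hY hlt using hmax
  obtain ⟨⟨x, y⟩, ⟨hx, hy⟩, φ, hφ, hlim⟩ := (P.cpt.prod P.cpt).tendsto_subseq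
    (x := fun n => (X n, Y n)) (fun n => ⟨hX n, hY n⟩)
  have hXl : Tendsto (fun n => X (φ n)) atTop (𝓝 x) := (continuous_fst.tendsto _).comp hlim
  have hYl : Tendsto (fun n => Y (φ n)) atTop (𝓝 y) := (continuous_snd.tendsto _).comp hlim
  have hrl : Tendsto (fun n => R + 1 / ((φ n : ℝ) + 1)) atTop (𝓝 R) := by
    have := (tendsto_one_div_add_atTop_nhds_zero_nat (𝕜 := ℝ)).comp hφ.tendsto_atTop
    simpa [Function.comp_def] using this.const_add R
  simp only at hx hy
  have hNl : Tendsto (fun n => N (X (φ n))) atTop (𝓝 (N x)) :=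
    ((hA x hx).hasFDerivAt.continuousAt.tendsto).comp hXl
  have hdl := hYl.sub hXl
  by_cases hxy : x = y
  · exfalso
    subst hxy
    obtain ⟨L, hL, hLR, δ, hδ, hlip⟩ := P.locLip hx (hA x hx) (hk x hx) (hkR x hx)
    rw [sub_self] at hdl
    have hq0 : Tendsto (fun n => ‖Y (φ n) - X (φ n)‖) atTop (𝓝 0) := by
      simpa using hdl.norm
    have hlim2 : Tendsto (fun n => 2 * (R + 1 / ((φ n : ℝ) + 1)) * ((1 / R + L) *
        (1 / 2 + ‖Y (φ n) - X (φ n)‖ / R) ^ 2)) atTop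
        (𝓝 (2 * R * ((1 / R + L) * (1 / 2 + 0 / R) ^ 2))) :=
      (hrl.const_mul 2).mul ((((hq0.div_const R).const_add _).pow 2).const_mul _)
    have hx4 := (tendsto_iff_norm_sub_tendsto_zero.1 hXl).eventually_lt_const
      (show (0 : ℝ) < δ / 4 by linarith)
    have hy4 := (tendsto_iff_norm_sub_tendsto_zero.1 hYl).eventually_lt_const
      (show (0 : ℝ) < δ / 4 by linarith)
    have hqR := hq0.eventually_lt_const hpos
    have hge : ∀ᶠ n in atTop, 1 ≤ 2 * (R + 1 / ((φ n : ℝ) + 1)) * ((1 / R + L) *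
        (1 / 2 + ‖Y (φ n) - X (φ n)‖ / R) ^ 2) := by
      filter_upwards [hx4, hy4, hqR] with n h1 h2 h3
      have h4 := P.improved hL hlip (hX (φ n)) (hY (φ n)) h1 h2 h3
      have h5 := hlt (φ n)
      set q := ‖Y (φ n) - X (φ n)‖ with hq
      set r := R + 1 / ((φ n : ℝ) + 1) with hr
      have hr0 : 0 < r := by positivity
      by_contra! hc
      have h6 : q ^ 2 < 2 * r * ((1 / R + L) * (q / 2 + q ^ 2 / R) ^ 2) :=
        h5.trans_le (by gcongr)
      have h7 : 2 * r * ((1 / R + L) * (q / 2 + q ^ 2 / R) ^ 2)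
        = q ^ 2 * (2 * r * ((1 / R + L) * (1 / 2 + q / R) ^ 2)) := by ring
      nlinarith [sq_nonneg q]
    have hfin := ge_of_tendsto hlim2 hge
    have : 2 * R * ((1 / R + L) * (1 / 2 + 0 / R) ^ 2) = (1 + L * R) / 2 := by
      field_simp; ring
    rw [this] at hfin
    linarith
  · refine ⟨x, hx, y, hy, ?_⟩
    refine P.contact hx hy hxy (hA x hx).hasFDerivAt (hk x hx) (hkR x hx) ?_
    exact le_of_tendsto_of_tendsto' (hdl.norm.pow 2)
      ((hrl.const_mul 2).mul (hdl.inner hNl).abs) (fun n => (hlt (φ n)).le)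

/-- Proposition 2.2: for a bounded `C²`-regular planar domain, either
the sup-norm of the curvature equals `1/r_Ω`, or there are boundary points `x, y` with
`y = x ± 2 r_Ω ν(x)` and `ν(x) = -ν(y)`. -/
theorem ubc_radius_dichotomy (D : C2Domain) :
    sSup ((fun x => |D.kappa x|) '' frontier D.carrier) = 1 / ubcRadius D.carrier ∨
    ∃ x ∈ frontier D.carrier, ∃ y ∈ frontier D.carrier,
      (y = x + (2 * ubcRadius D.carrier) • D.nu x ∨
        y = x - (2 * ubcRadius D.carrier) • D.nu x) ∧
      D.nu x = -D.nu y := by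
  have P := pkg D
  have hpos := P.pos
  obtain ⟨U, hU, hFU, hreg⟩ := D.nu_reg
  have hA : ∀ x ∈ frontier D.carrier, HasStrictFDerivAt D.nu (fderiv ℝ D.nu x) x := fun x hx =>
    (hreg.contDiffAt (hU.mem_nhds (hFU hx))).hasStrictFDerivAt one_ne_zero
  have hτ : ∀ x ∈ frontier D.carrier, ‖rot (D.nu x)‖ = 1 := fun x hx => by
    rw [norm_rot, P.unit x hx]
  have hk : ∀ x ∈ frontier D.carrier,
      fderiv ℝ D.nu x (rot (D.nu x)) = D.kappa x • rot (D.nu x) := by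
    intro x hx
    have h1 := P.deriv_orth hx (hA x hx).hasFDerivAt (hτ x hx) (inner_rot _)
    have h2 := decomp (D.nu x) (fderiv ℝ D.nu x (rot (D.nu x))) (P.unit x hx)
    rw [h1, zero_smul, zero_add, ← D.kappa_eq x hx] at h2
    exact h2
  have hle : ∀ x ∈ frontier D.carrier, |D.kappa x| ≤ 1 / ubcRadius D.carrier := by
    intro x hx
    have h1 := P.deriv_norm hx (hA x hx).hasFDerivAt (hτ x hx) (inner_rot _)
    rw [hk x hx, norm_smul, hτ x hx, mul_one, Real.norm_eq_abs] at h1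
    rwa [le_div_iff₀ hpos]
  by_cases hs : sSup ((fun x => |D.kappa x|) '' frontier D.carrier) = 1 / ubcRadius D.carrier
  · exact Or.inl hs
  right
  have hub : ∀ b ∈ (fun x => |D.kappa x|) '' frontier D.carrier, b ≤ 1 / ubcRadius D.carrier := by
    rintro _ ⟨x, hx, rfl⟩
    exact hle x hx
  have hlt := lt_of_le_of_ne (csSup_le (P.ne.image _) hub) hs
  refine P.main hA hk fun x hx => ?_
  rw [← lt_div_iff₀ hpos]
  exact (le_csSup ⟨_, hub⟩ (mem_image_of_mem _ hx)).trans_lt hlt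

end StokesPaper

end
end

section
/- Let Ω ⊂ ℝ² be a UBC domain. There exists an independent constant C such that for every f ∈ H²(Ω): (i) ‖∇f‖_{L²(Ω)} ≤ C (‖∇²f‖_{L²(Ω)}^{1/2} ‖f‖_{L²(Ω)}^{1/2} + ‖f‖_{L²(Ω)} / r_Ω), and (ii) ‖f‖_{L∞(Ω)} ≤ C (‖∇²f‖_{L²(Ω)}^{1/2} ‖f‖_{L²(Ω)}^{1/2} + ‖f‖_{L²(Ω)} / r_Ω). -/
open MeasureTheory Metric Set Filter
open scoped RealInnerProductSpace ENNReal Topology NNReal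

noncomputable section

namespace StokesPaper

/-- Geometry: each point of a UBC set lies in an interior ball of radius `r`. -/
lemma exists_ball_of_ubc {Ω : Set E2} (ho : IsOpen Ω) (hne : (frontier Ω).Nonempty) {r : ℝ}
    (h : IsUBCWith Ω r) {x : E2} (hx : x ∈ Ω) : ∃ c, x ∈ ball c r ∧ ball c r ⊆ Ω := by
  obtain ⟨hr, h⟩ := h
  obtain ⟨y, hy, hxy⟩ := isClosed_frontier.exists_infDist_eq_dist hne x
  have hyΩ : y ∉ Ω := by
    have := hy.2
    rwa [ho.interior_eq] at this
  have hd : 0 < dist x y := dist_pos.2 (by rintro rfl; exact hyΩ hx)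
  have hsub : ball x (dist x y) ⊆ Ω := by
    have hpre : IsPreconnected (ball x (dist x y)) := (convex_ball x _).isPreconnected
    by_contra hcon
    obtain ⟨w, hw, hwΩ⟩ := not_subset.1 hcon
    have h1 : (ball x (dist x y) ∩ Ω).Nonempty := ⟨x, mem_ball_self hd, hx⟩
    have hnf : ∀ q ∈ ball x (dist x y), q ∉ frontier Ω := by
      intro q hq1 hq2
      have := infDist_le_dist_of_mem (x := x) hq2
      rw [hxy] at this
      rw [mem_ball, dist_comm] at hq1
      linarith
    have hcl : ∀ q ∈ ball x (dist x y), q ∉ Ω → q ∉ closure Ω := by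
      intro q hq hqΩ hqc
      exact hnf q hq ⟨hqc, by rwa [ho.interior_eq]⟩
    obtain ⟨q, -, hq1, hq2⟩ := hpre Ω (closure Ω)ᶜ ho isClosed_closure.isOpen_compl
      (fun q hq => by
        by_cases hqΩ : q ∈ Ω
        · exact Or.inl hqΩ
        · exact Or.inr (hcl q hq hqΩ)) h1 ⟨w, hw, hcl w hw hwΩ⟩
    exact hq2 (subset_closure hq1)
  by_cases hcase : r ≤ dist x y
  · exact ⟨x, mem_ball_self hr, (ball_subset_ball hcase).trans hsub⟩
  push Not at hcase
  obtain ⟨cI, cO, hI, hO, hS⟩ := h y hy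
  have hyS : y ∈ sphere cI r ∩ sphere cO r := by rw [hS]; rfl
  refine ⟨cI, ?_, hI⟩
  have d1 : dist x y + r ≤ dist x cO :=
    (disjoint_ball_ball_iff hd hr).1 (disjoint_compl_right.mono hsub hO)
  have d2 : r + r ≤ dist cI cO :=
    (disjoint_ball_ball_iff hr hr).1 (disjoint_compl_right.mono hI hO)
  have e1 : ‖cI - y‖ = r := by rw [← dist_eq_norm, dist_comm]; exact hyS.1
  have e2 : ‖cO - y‖ = r := by rw [← dist_eq_norm, dist_comm]; exact hyS.2
  rw [mem_ball, dist_eq_norm]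
  have e3 : dist x y = ‖x - y‖ := dist_eq_norm _ _
  rw [e3] at hd hcase d1
  have f1 : x - cO = (x - y) - (cO - y) := by abel
  have f2 : cI - cO = (cI - y) - (cO - y) := by abel
  have f3 : x - cI = (x - y) - (cI - y) := by abel
  rw [dist_eq_norm, f1] at d1
  rw [dist_eq_norm, f2] at d2
  rw [f3]
  generalize x - y = u at *
  generalize cI - y = w at *
  generalize cO - y = v at *
  have g1 := norm_sub_sq_real u v
  have g2 := norm_sub_sq_real w v
  have g3 := norm_add_sq_real w v
  have g4 := norm_sub_sq_real u w
  have i1 : ‖w + v‖ ^ 2 ≤ 0 := by nlinarith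
  have i2 : w + v = 0 := by
    have : ‖w + v‖ = 0 := by nlinarith [norm_nonneg (w + v)]
    exact norm_eq_zero.1 this
  have i3 : w = - v := eq_neg_of_add_eq_zero_left i2
  have i4 : ⟪u, w⟫ = - ⟪u, v⟫ := by rw [i3, inner_neg_right]
  have i5 : ‖u - w‖ ^ 2 ≤ (r - ‖u‖) ^ 2 := by nlinarith
  have := abs_le_of_sq_le_sq i5 (by linarith)
  rw [abs_norm] at this
  linarith

/-- Shrinking the ball. -/
lemma exists_ball_shrink {Ω : Set E2} {r s : ℝ} (hs : 0 < s) (hsr : s ≤ r) {x : E2}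
    (h : ∃ c, x ∈ ball c r ∧ ball c r ⊆ Ω) : ∃ c, x ∈ ball c s ∧ ball c s ⊆ Ω := by
  obtain ⟨c, hx, hc⟩ := h
  have hr : 0 < r := hs.trans_le hsr
  have hq : s / r ≤ 1 := (div_le_one hr).2 hsr
  have hq0 : 0 < s / r := by positivity
  have hqr : s / r * r = s := by field_simp
  rw [mem_ball, dist_eq_norm] at hx
  have hx' : ‖c - x‖ < r := by rwa [norm_sub_rev]
  refine ⟨x + (s / r) • (c - x), ?_, ?_⟩
  · rw [mem_ball, dist_eq_norm, sub_add_cancel_left, norm_neg, norm_smul, Real.norm_of_nonneg hq0.le]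
    nlinarith
  · refine (ball_subset_ball' ?_).trans hc
    have : x + (s / r) • (c - x) - c = (1 - s / r) • (x - c) := by module
    rw [dist_eq_norm, this, norm_smul, Real.norm_of_nonneg (by linarith)]
    nlinarith

/-- Jensen on `[0,1]`. -/
lemma sq_integral_le {u : ℝ → ℝ} (hu : ContinuousOn u (Icc 0 1)) :
    (∫ t in (0:ℝ)..1, u t) ^ 2 ≤ ∫ t in (0:ℝ)..1, (u t) ^ 2 := by
  set m := ∫ t in (0:ℝ)..1, u t with hm
  have hu' : ContinuousOn u (uIcc 0 1) := by rwa [uIcc_of_le zero_le_one]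
  have h0 : 0 ≤ ∫ t in (0:ℝ)..1, (u t - m) ^ 2 :=
    intervalIntegral.integral_nonneg zero_le_one (fun t _ => sq_nonneg _)
  have h1 : ∫ t in (0:ℝ)..1, (u t - m) ^ 2
      = (∫ t in (0:ℝ)..1, (u t) ^ 2) - 2 * m * (∫ t in (0:ℝ)..1, u t) + m ^ 2 := by
    have : ∀ t, (u t - m) ^ 2 = ((u t) ^ 2 - 2 * m * u t) + m ^ 2 := fun t => by ring
    simp_rw [this]
    rw [intervalIntegral.integral_add, intervalIntegral.integral_sub,
      intervalIntegral.integral_const_mul]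
    · simp
    · exact (hu'.pow 2).intervalIntegrable
    · exact (continuousOn_const.mul hu').intervalIntegrable
    · exact ((hu'.pow 2).sub (continuousOn_const.mul hu')).intervalIntegrable
    · exact intervalIntegrable_const
  rw [h1, ← hm] at h0
  nlinarith

lemma oneD_aux {g g' g'' K K' K'' : ℝ → ℝ}
    (hg : ∀ t ∈ Icc (0:ℝ) 1, HasDerivAt g (g' t) t)
    (hg' : ∀ t ∈ Icc (0:ℝ) 1, HasDerivAt g' (g'' t) t)
    (hc : ContinuousOn g'' (Icc 0 1))
    (hK : ∀ t, HasDerivAt K (K' t) t) (hK' : ∀ t, HasDerivAt K' (K'' t) t)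
    (hKc : Continuous K'') (h1 : K 1 = 0) (h2 : K' 1 = 0) :
    (K' 0 * g 0 - K 0 * g' 0) ^ 2 ≤
      ∫ t in (0:ℝ)..1, (2 * (K'' t) ^ 2 * (g t) ^ 2 + 2 * (K t) ^ 2 * (g'' t) ^ 2) := by
  have cg : ContinuousOn g (Icc 0 1) := fun t ht => (hg t ht).continuousAt.continuousWithinAt
  have cK : ContinuousOn K (Icc 0 1) := fun t ht => (hK t).continuousAt.continuousWithinAt
  have cK' : ContinuousOn K'' (Icc 0 1) := hKc.continuousOn
  have cu : ContinuousOn (fun t => K t * g'' t - K'' t * g t) (Icc 0 1) :=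
    (cK.mul hc).sub (cK'.mul cg)
  have e : uIcc (0:ℝ) 1 = Icc 0 1 := uIcc_of_le zero_le_one
  have key : ∫ t in (0:ℝ)..1, (K t * g'' t - K'' t * g t) = K' 0 * g 0 - K 0 * g' 0 := by
    rw [intervalIntegral.integral_eq_sub_of_hasDerivAt (f := fun t => K t * g' t - K' t * g t)]
    · rw [h1, h2]; ring
    · intro t ht
      rw [e] at ht
      have := ((hK t).mul (hg' t ht)).sub ((hK' t).mul (hg t ht))
      have e2 : K t * g'' t - K'' t * g t
          = K' t * g' t + K t * g'' t - (K'' t * g t + K' t * g' t) := by ring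
      rw [e2]
      exact this
    · apply ContinuousOn.intervalIntegrable
      rw [e]; exact cu
  rw [← key]
  refine (sq_integral_le cu).trans ?_
  apply intervalIntegral.integral_mono_on zero_le_one
  · apply ContinuousOn.intervalIntegrable
    rw [e]; exact cu.pow 2
  · apply ContinuousOn.intervalIntegrable
    rw [e]
    exact ((continuousOn_const.mul (cK'.pow 2)).mul (cg.pow 2)).add
      ((continuousOn_const.mul (cK.pow 2)).mul (hc.pow 2))
  · intro t _
    nlinarith [sq_nonneg (K t * g'' t + K'' t * g t)]

/-- The integrand `648 f² + 2 R⁴ |∇²f|²`. -/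
def dens (f : E2 → ℝ) (R : ℝ) (y : E2) : ℝ :=
  648 * (f y) ^ 2 + 2 * R ^ 4 * ‖iteratedFDeriv ℝ 2 f y‖ ^ 2

lemma dens_nonneg (f : E2 → ℝ) (R : ℝ) (y : E2) : 0 ≤ dens f R y := by
  unfold dens; positivity

lemma continuousOn_iter {Ω : Set E2} (ho : IsOpen Ω) {f : E2 → ℝ} (hf : ContDiffOn ℝ 2 f Ω) :
    ContinuousOn (fun y => iteratedFDeriv ℝ 2 f y) Ω := by
  have h := hf.continuousOn_iteratedFDerivWithin (m := 2) le_rfl ho.uniqueDiffOn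
  exact h.congr (fun y hy => (iteratedFDerivWithin_of_isOpen 2 ho hy).symm)

lemma continuousOn_dens {Ω : Set E2} (ho : IsOpen Ω) {f : E2 → ℝ} (hf : ContDiffOn ℝ 2 f Ω)
    (R : ℝ) : ContinuousOn (dens f R) Ω := by
  unfold dens
  exact (continuousOn_const.mul (hf.continuousOn.pow 2)).add
    (continuousOn_const.mul ((continuousOn_iter ho hf).norm.pow 2))

/-- Both one-dimensional estimates along a segment. -/
lemma seg_est {Ω : Set E2} (ho : IsOpen Ω) {f : E2 → ℝ} (hf : ContDiffOn ℝ 2 f Ω)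
    {x z : E2} {R : ℝ} (hz : ‖z‖ ≤ R) (hseg : ∀ t ∈ Icc (0:ℝ) 1, x + t • z ∈ Ω) :
    (f x) ^ 2 ≤ ∫ t in (0:ℝ)..1, t ^ 2 * dens f R (x + t • z) ∧
    (fderiv ℝ f x z) ^ 2 ≤ ∫ t in (0:ℝ)..1, dens f R (x + t • z) := by
  have hline : ∀ t : ℝ, HasDerivAt (fun t : ℝ => x + t • z) z t := by
    intro t
    simpa using ((hasDerivAt_id t).smul_const z).const_add x
  have hcl : Continuous (fun t : ℝ => x + t • z) := by fun_prop
  have hmaps : MapsTo (fun t : ℝ => x + t • z) (Icc 0 1) Ω := hseg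
  have hdf : ContDiffOn ℝ 1 (fderiv ℝ f) Ω := hf.fderiv_of_isOpen ho (by norm_num)
  have hg : ∀ t ∈ Icc (0:ℝ) 1,
      HasDerivAt (fun t : ℝ => f (x + t • z)) (fderiv ℝ f (x + t • z) z) t := by
    intro t ht
    have h1 : DifferentiableAt ℝ f (x + t • z) :=
      (hf.differentiableOn (by norm_num)).differentiableAt (ho.mem_nhds (hseg t ht))
    exact h1.hasFDerivAt.comp_hasDerivAt t (hline t)
  have hg' : ∀ t ∈ Icc (0:ℝ) 1,
      HasDerivAt (fun t : ℝ => fderiv ℝ f (x + t • z) z)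
        (fderiv ℝ (fderiv ℝ f) (x + t • z) z z) t := by
    intro t ht
    have h1 : DifferentiableAt ℝ (fderiv ℝ f) (x + t • z) :=
      (hdf.differentiableOn (by norm_num)).differentiableAt (ho.mem_nhds (hseg t ht))
    have h2 := h1.hasFDerivAt.comp_hasDerivAt t (hline t)
    simpa using h2.clm_apply (hasDerivAt_const t z)
  have hcD : ContinuousOn (fun t : ℝ => fderiv ℝ (fderiv ℝ f) (x + t • z) z z) (Icc 0 1) := by
    have h1 : ContinuousOn (fderiv ℝ (fderiv ℝ f)) Ω :=
      hdf.continuousOn_fderiv_of_isOpen ho (by norm_num)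
    have h2 := h1.comp hcl.continuousOn hmaps
    exact (h2.clm_apply continuousOn_const).clm_apply continuousOn_const
  have hbd : ∀ t : ℝ, (fderiv ℝ (fderiv ℝ f) (x + t • z) z z) ^ 2
      ≤ R ^ 4 * ‖iteratedFDeriv ℝ 2 f (x + t • z)‖ ^ 2 := by
    intro t
    have h1 := (iteratedFDeriv ℝ 2 f (x + t • z)).le_opNorm ![z, z]
    rw [iteratedFDeriv_two_apply] at h1
    simp [Fin.prod_univ_two] at h1
    have h2 : |fderiv ℝ (fderiv ℝ f) (x + t • z) z z|
        ≤ ‖iteratedFDeriv ℝ 2 f (x + t • z)‖ * (R * R) := by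
      refine h1.trans ?_
      have hz0 := norm_nonneg z
      have hR := hz0.trans hz
      gcongr
    calc (fderiv ℝ (fderiv ℝ f) (x + t • z) z z) ^ 2
        = |fderiv ℝ (fderiv ℝ f) (x + t • z) z z| ^ 2 := (sq_abs _).symm
      _ ≤ (‖iteratedFDeriv ℝ 2 f (x + t • z)‖ * (R * R)) ^ 2 := by gcongr
      _ = _ := by ring
  have hcf : ContinuousOn (fun t : ℝ => f (x + t • z)) (Icc 0 1) :=
    hf.continuousOn.comp hcl.continuousOn hmaps
  have hcd : ContinuousOn (fun t : ℝ => dens f R (x + t • z)) (Icc 0 1) :=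
    (continuousOn_dens ho hf R).comp hcl.continuousOn hmaps
  have e : uIcc (0:ℝ) 1 = Icc 0 1 := uIcc_of_le zero_le_one
  constructor
  · have key := oneD_aux (K := fun t => 3 * t ^ 3 - 2 * t ^ 4 - t)
      (K' := fun t => 9 * t ^ 2 - 8 * t ^ 3 - 1) (K'' := fun t => 18 * t - 24 * t ^ 2)
      hg hg' hcD
      (fun t => by
        have := (((hasDerivAt_pow 3 t).const_mul 3).sub ((hasDerivAt_pow 4 t).const_mul 2)).sub
          (hasDerivAt_id t)
        refine this.congr_deriv ?_
        push_cast; ring)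
      (fun t => by
        have := (((hasDerivAt_pow 2 t).const_mul 9).sub ((hasDerivAt_pow 3 t).const_mul 8)).sub
          (hasDerivAt_const t (1:ℝ))
        refine this.congr_deriv ?_
        push_cast; ring)
      (by fun_prop) (by norm_num) (by norm_num)
    norm_num at key
    refine key.trans ?_
    apply intervalIntegral.integral_mono_on zero_le_one
    · apply ContinuousOn.intervalIntegrable
      rw [e]
      exact (ContinuousOn.mul (by fun_prop) (hcf.pow 2)).add
        (ContinuousOn.mul (by fun_prop) (hcD.pow 2))
    · apply ContinuousOn.intervalIntegrable
      rw [e]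
      exact ContinuousOn.mul (by fun_prop) hcd
    · intro t ht
      have hk1 : (18 * t - 24 * t ^ 2) ^ 2 ≤ 324 * t ^ 2 := by
        have : (18 - 24 * t) ^ 2 ≤ 324 := by nlinarith [ht.1, ht.2]
        nlinarith [sq_nonneg t]
      have hk2 : (3 * t ^ 3 - 2 * t ^ 4 - t) ^ 2 ≤ t ^ 2 := by
        have h0 : 0 ≤ 3 * t ^ 2 - 2 * t ^ 3 := by nlinarith [ht.1, ht.2, sq_nonneg t]
        have h1 : 3 * t ^ 2 - 2 * t ^ 3 ≤ 1 := by nlinarith [ht.1, ht.2, sq_nonneg (t - 1)]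
        have : (3 * t ^ 2 - 2 * t ^ 3 - 1) ^ 2 ≤ 1 := by nlinarith
        nlinarith [sq_nonneg t]
      unfold dens
      have := hbd t
      have a1 := mul_le_mul_of_nonneg_right hk1 (sq_nonneg (f (x + t • z)))
      have a2 := mul_le_mul hk2 this (sq_nonneg _) (sq_nonneg t)
      nlinarith
  · have key := oneD_aux (K := fun t => 1 - 3 * t ^ 2 + 2 * t ^ 3)
      (K' := fun t => -6 * t + 6 * t ^ 2) (K'' := fun t => -6 + 12 * t)
      hg hg' hcD
      (fun t => by
        have := ((hasDerivAt_const t (1:ℝ)).sub ((hasDerivAt_pow 2 t).const_mul 3)).add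
          ((hasDerivAt_pow 3 t).const_mul 2)
        refine this.congr_deriv ?_
        push_cast; ring)
      (fun t => by
        have := ((hasDerivAt_id t).const_mul (-6)).add ((hasDerivAt_pow 2 t).const_mul 6)
        refine this.congr_deriv ?_
        push_cast; ring)
      (by fun_prop) (by norm_num) (by norm_num)
    norm_num at key
    refine key.trans ?_
    apply intervalIntegral.integral_mono_on zero_le_one
    · apply ContinuousOn.intervalIntegrable
      rw [e]
      exact (ContinuousOn.mul (by fun_prop) (hcf.pow 2)).add
        (ContinuousOn.mul (by fun_prop) (hcD.pow 2))
    · apply ContinuousOn.intervalIntegrable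
      rw [e]
      exact hcd
    · intro t ht
      have hk1 : (-6 + 12 * t) ^ 2 ≤ 324 := by nlinarith [ht.1, ht.2]
      have hk2 : (1 - 3 * t ^ 2 + 2 * t ^ 3) ^ 2 ≤ 1 := by
        have h0 : 0 ≤ 3 * t ^ 2 - 2 * t ^ 3 := by nlinarith [ht.1, ht.2, sq_nonneg t]
        have h1 : 3 * t ^ 2 - 2 * t ^ 3 ≤ 1 := by nlinarith [ht.1, ht.2, sq_nonneg (t - 1)]
        nlinarith
      unfold dens
      have := hbd t
      have a1 := mul_le_mul_of_nonneg_right hk1 (sq_nonneg (f (x + t • z)))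
      have a2 := mul_le_mul hk2 this (sq_nonneg _) zero_le_one
      nlinarith

/-- The density, extended by zero, as an `ℝ≥0∞`-valued function. -/
def edens (Ω : Set E2) (f : E2 → ℝ) (R : ℝ) : E2 → ℝ≥0∞ :=
  Ω.indicator (fun y => ENNReal.ofReal (dens f R y))

lemma measurable_edens {Ω : Set E2} (ho : IsOpen Ω) {f : E2 → ℝ} (hf : ContDiffOn ℝ 2 f Ω)
    (R : ℝ) : Measurable (edens Ω f R) := by
  classical
  unfold edens
  rw [← Set.piecewise_eq_indicator]
  refine ContinuousOn.measurable_piecewise ?_ continuousOn_const ho.measurableSet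
  exact ENNReal.continuous_ofReal.comp_continuousOn (continuousOn_dens ho hf R)

/-- Both estimates in `ℝ≥0∞` form. -/
lemma seg_est_enn {Ω : Set E2} (ho : IsOpen Ω) {f : E2 → ℝ} (hf : ContDiffOn ℝ 2 f Ω)
    {x z : E2} {R : ℝ} (hz : ‖z‖ ≤ R) (hseg : ∀ t ∈ Icc (0:ℝ) 1, x + t • z ∈ Ω) :
    ENNReal.ofReal ((f x) ^ 2)
      ≤ ∫⁻ t in Ioc (0:ℝ) 1, ENNReal.ofReal (t ^ 2) * edens Ω f R (x + t • z) ∧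
    ENNReal.ofReal ((fderiv ℝ f x z) ^ 2)
      ≤ ∫⁻ t in Ioc (0:ℝ) 1, edens Ω f R (x + t • z) := by
  obtain ⟨h1, h2⟩ := seg_est ho hf hz hseg
  have hcl : Continuous (fun t : ℝ => x + t • z) := by fun_prop
  have hmaps : MapsTo (fun t : ℝ => x + t • z) (Icc 0 1) Ω := hseg
  have hcd : ContinuousOn (fun t : ℝ => dens f R (x + t • z)) (Icc 0 1) :=
    (continuousOn_dens ho hf R).comp hcl.continuousOn hmaps
  have hcd2 : ContinuousOn (fun t : ℝ => t ^ 2 * dens f R (x + t • z)) (Icc 0 1) :=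
    ContinuousOn.mul (by fun_prop) hcd
  have conv : ∀ u : ℝ → ℝ, ContinuousOn u (Icc 0 1) → (∀ t, 0 ≤ u t) →
      ENNReal.ofReal (∫ t in (0:ℝ)..1, u t) = ∫⁻ t in Ioc (0:ℝ) 1, ENNReal.ofReal (u t) := by
    intro u hu hu0
    rw [intervalIntegral.integral_of_le zero_le_one]
    apply ofReal_integral_eq_lintegral_ofReal
    · exact (hu.integrableOn_Icc).mono_set Ioc_subset_Icc_self
    · exact Eventually.of_forall hu0
  constructor
  · refine (ENNReal.ofReal_le_ofReal h1).trans ?_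
    rw [conv _ hcd2 (fun t => mul_nonneg (sq_nonneg _) (dens_nonneg _ _ _))]
    refine setLIntegral_mono' measurableSet_Ioc (fun t ht => ?_)
    rw [edens, indicator_of_mem (hseg t (Ioc_subset_Icc_self ht)),
      ENNReal.ofReal_mul (sq_nonneg t)]
  · refine (ENNReal.ofReal_le_ofReal h2).trans ?_
    rw [conv _ hcd (fun t => dens_nonneg _ _ _)]
    refine setLIntegral_mono' measurableSet_Ioc (fun t ht => ?_)
    rw [edens, indicator_of_mem (hseg t (Ioc_subset_Icc_self ht))]

lemma lintegral_scale {H : E2 → ℝ≥0∞} (hH : Measurable H) (x : E2) {t : ℝ} (ht : 0 < t) :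
    ENNReal.ofReal (t ^ 2) * ∫⁻ z, H (x + t • z) = ∫⁻ y, H y := by
  have h1 : ∫⁻ z, H (x + t • z) = ∫⁻ w, H (x + w) ∂(Measure.map (fun z : E2 => t • z) volume) := by
    rw [lintegral_map (f := fun w => H (x + w)) (by fun_prop) (by fun_prop)]
  have h2 := Measure.map_addHaar_smul (volume : Measure E2) ht.ne'
  rw [h1, h2, lintegral_smul_measure, lintegral_add_left_eq_self]
  have h3 : Module.finrank ℝ E2 = 2 := by simp
  rw [h3, smul_eq_mul, ← mul_assoc, ← ENNReal.ofReal_mul (by positivity),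
    abs_of_pos (by positivity), mul_inv_cancel₀ (by positivity)]
  simp

lemma lintegral_edens {Ω : Set E2} (ho : IsOpen Ω) {f : E2 → ℝ} (R : ℝ)
    (i1 : IntegrableOn (fun x => (f x)^2) Ω)
    (i2 : IntegrableOn (fun x => ‖iteratedFDeriv ℝ 2 f x‖^2) Ω) :
    ∫⁻ y, edens Ω f R y = ENNReal.ofReal (648 * (∫ x in Ω, (f x)^2) +
      2 * R ^ 4 * ∫ x in Ω, ‖iteratedFDeriv ℝ 2 f x‖^2) := by
  unfold edens
  rw [lintegral_indicator ho.measurableSet, ← ofReal_integral_eq_lintegral_ofReal]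
  · congr 1
    unfold dens
    rw [integral_add (i1.const_mul _) (i2.const_mul _), integral_const_mul, integral_const_mul]
  · exact (i1.const_mul _).add (i2.const_mul _)
  · exact Eventually.of_forall (dens_nonneg f R)

lemma mem_seg {Ω : Set E2} {c x z : E2} {s : ℝ} (hx : x ∈ ball c s) (hc : ball c s ⊆ Ω)
    (hz : z ∈ ball (c - x) s) : ∀ t ∈ Icc (0:ℝ) 1, x + t • z ∈ Ω := by
  intro t ht
  apply hc
  have hxz : x + z ∈ ball c s := by
    rw [mem_ball, dist_eq_norm] at hz ⊢
    have : x + z - c = z - (c - x) := by abel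
    rwa [this]
  have := (convex_ball c s).add_smul_sub_mem hx hxz ht
  simpa using this

lemma norm_z_le {c x z : E2} {s : ℝ} (hx : x ∈ ball c s) (hz : z ∈ ball (c - x) s) :
    ‖z‖ < 2 * s := by
  rw [mem_ball, dist_eq_norm] at hz hx
  have : z = (z - (c - x)) - (x - c) := by abel
  rw [this]
  refine (norm_sub_le _ _).trans_lt ?_
  linarith

lemma sup_est_enn {Ω : Set E2} (ho : IsOpen Ω) {f : E2 → ℝ} (hf : ContDiffOn ℝ 2 f Ω)
    {c x : E2} {s : ℝ} (hx : x ∈ ball c s) (hc : ball c s ⊆ Ω) :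
    ENNReal.ofReal ((f x) ^ 2) * volume (ball (c - x) s) ≤ ∫⁻ y, edens Ω f (2 * s) y := by
  have hH := measurable_edens ho hf (2 * s)
  set H := edens Ω f (2 * s)
  calc ENNReal.ofReal ((f x) ^ 2) * volume (ball (c - x) s)
      = ∫⁻ z in ball (c - x) s, ENNReal.ofReal ((f x) ^ 2) := by
        rw [setLIntegral_const]
    _ ≤ ∫⁻ z in ball (c - x) s, ∫⁻ t in Ioc (0:ℝ) 1, ENNReal.ofReal (t ^ 2) * H (x + t • z) :=
        setLIntegral_mono' measurableSet_ball (fun z hz =>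
          (seg_est_enn ho hf (norm_z_le hx hz).le (mem_seg hx hc hz)).1)
    _ ≤ ∫⁻ z, ∫⁻ t in Ioc (0:ℝ) 1, ENNReal.ofReal (t ^ 2) * H (x + t • z) :=
        setLIntegral_le_lintegral _ _
    _ = ∫⁻ t in Ioc (0:ℝ) 1, ∫⁻ z, ENNReal.ofReal (t ^ 2) * H (x + t • z) := by
        apply lintegral_lintegral_swap
        apply Measurable.aemeasurable
        unfold Function.uncurry
        fun_prop
    _ = ∫⁻ t in Ioc (0:ℝ) 1, ∫⁻ y, H y := by
        refine setLIntegral_congr_fun measurableSet_Ioc (fun t ht => ?_)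
        rw [lintegral_const_mul _ (by fun_prop), lintegral_scale hH x ht.1]
    _ = ∫⁻ y, H y := by simp

/-- A linear functional is large on a quarter ball. -/
lemma exists_quarter (l : E2 →L[ℝ] ℝ) (a : E2) {s : ℝ} (hs : 0 < s) :
    ∃ b, ball b (s / 4) ⊆ ball a s ∧ ∀ z ∈ ball b (s / 4), (‖l‖ * (s / 4)) ^ 2 ≤ (l z) ^ 2 := by
  obtain ⟨v, hv⟩ : ∃ v : E2, ‖v‖ ≤ 1 ∧ l v = ‖l‖ := by
    by_cases hl : l = 0
    · exact ⟨0, by simp, by simp [hl]⟩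
    · set w := (InnerProductSpace.toDual ℝ E2).symm l with hw
      have h1 : ‖w‖ = ‖l‖ := by simp [hw]
      have h2 : l w = ‖w‖ ^ 2 := by
        have : l w = ⟪w, w⟫ := by rw [hw, InnerProductSpace.toDual_symm_apply]
        rw [this, real_inner_self_eq_norm_sq]
      have h3 : ‖l‖ ≠ 0 := norm_ne_zero_iff.2 hl
      refine ⟨‖l‖⁻¹ • w, ?_, ?_⟩
      · rw [norm_smul, h1]; simp [h3]
      · rw [map_smul, h2, h1, smul_eq_mul]; field_simp
  obtain ⟨hv1, hv2⟩ := hv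
  have main : ∀ σ : ℝ, |σ| = 1 → 0 ≤ σ * l a →
      ball (a + (σ * (s / 2)) • v) (s / 4) ⊆ ball a s ∧
      ∀ z ∈ ball (a + (σ * (s / 2)) • v) (s / 4), (‖l‖ * (s / 4)) ^ 2 ≤ (l z) ^ 2 := by
    intro σ hσ hla
    have hσ2 : σ ^ 2 = 1 := by rw [← sq_abs, hσ]; norm_num
    constructor
    · apply ball_subset_ball'
      rw [dist_eq_norm, add_sub_cancel_left, norm_smul, norm_mul, Real.norm_eq_abs, hσ,
        Real.norm_of_nonneg (by positivity)]
      nlinarith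
    · intro z hz
      rw [mem_ball, dist_eq_norm] at hz
      have h1 := l.le_opNorm (z - (a + (σ * (s / 2)) • v))
      have h2 : l z = l (z - (a + (σ * (s / 2)) • v)) + l a + σ * (s / 2) * ‖l‖ := by
        rw [← hv2]; simp; ring
      have h3 : |l (z - (a + (σ * (s / 2)) • v))| ≤ ‖l‖ * (s / 4) :=
        h1.trans (by gcongr)
      generalize l (z - (a + (σ * (s / 2)) • v)) = q at *
      have h4 : |σ * q| ≤ ‖l‖ * (s / 4) := by rw [abs_mul, hσ, one_mul]; exact h3
      have h5 : σ * l z = σ * q + σ * l a + (s / 2) * ‖l‖ := by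
        rw [h2]; linear_combination (s / 2) * ‖l‖ * hσ2
      have h6 : ‖l‖ * (s / 4) ≤ σ * l z := by
        have := (abs_le.1 h4).1
        rw [h5]; nlinarith
      have h7 : (l z) ^ 2 = (σ * l z) ^ 2 := by rw [mul_pow, hσ2, one_mul]
      rw [h7]
      gcongr
  rcases le_total 0 (l a) with h | h
  · exact ⟨_, main 1 (by simp) (by simpa using h)⟩
  · exact ⟨_, main (-1) (by simp) (by linarith)⟩

lemma grad_est_enn {Ω : Set E2} (ho : IsOpen Ω) {f : E2 → ℝ} (hf : ContDiffOn ℝ 2 f Ω)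
    {s : ℝ} (hs : 0 < s) (hP : ∀ x ∈ Ω, ∃ c, x ∈ ball c s ∧ ball c s ⊆ Ω) :
    ∫⁻ x in Ω, ENNReal.ofReal ((‖fderiv ℝ f x‖ * (s / 4)) ^ 2) * volume (ball (0 : E2) (s / 4))
      ≤ (∫⁻ y, edens Ω f (2 * s) y) * volume (ball (0 : E2) (2 * s)) := by
  have hH := measurable_edens ho hf (2 * s)
  have pt : ∀ x ∈ Ω, ENNReal.ofReal ((‖fderiv ℝ f x‖ * (s / 4)) ^ 2) *
      volume (ball (0 : E2) (s / 4))
      ≤ ∫⁻ z in ball (0 : E2) (2 * s), ∫⁻ t in Ioc (0:ℝ) 1, edens Ω f (2 * s) (x + t • z) := by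
    intro x hx
    obtain ⟨c, hxc, hc⟩ := hP x hx
    obtain ⟨b, hb1, hb2⟩ := exists_quarter (fderiv ℝ f x) (c - x) hs
    have hb3 : ball b (s / 4) ⊆ ball (0 : E2) (2 * s) := by
      intro z hz
      rw [mem_ball_zero_iff]
      exact norm_z_le hxc (hb1 hz)
    have hvol : volume (ball (0 : E2) (s / 4)) = volume (ball b (s / 4)) := by
      rw [Measure.addHaar_ball_center, Measure.addHaar_ball_center volume b]
    rw [hvol, ← setLIntegral_const]
    refine (setLIntegral_mono' measurableSet_ball (fun z hz => ?_)).trans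
      (lintegral_mono_set hb3)
    refine (ENNReal.ofReal_le_ofReal (hb2 z hz)).trans ?_
    exact (seg_est_enn ho hf (norm_z_le hxc (hb1 hz)).le (mem_seg hxc hc (hb1 hz))).2
  set H := edens Ω f (2 * s)
  refine (setLIntegral_mono' ho.measurableSet pt).trans ?_
  refine (setLIntegral_le_lintegral _ _).trans ?_
  rw [lintegral_lintegral_swap]
  · have : ∀ z : E2, ∫⁻ x, ∫⁻ t in Ioc (0:ℝ) 1, H (x + t • z) = ∫⁻ y, H y := by
      intro z
      rw [lintegral_lintegral_swap]
      · simp_rw [lintegral_add_right_eq_self]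
        simp
      · apply Measurable.aemeasurable
        unfold Function.uncurry
        fun_prop
    simp_rw [this]
    rw [setLIntegral_const]
  · apply Measurable.aemeasurable
    unfold Function.uncurry
    have hm : Measurable (fun q : (E2 × E2) × ℝ => H (q.1.1 + q.2 • q.1.2)) := by fun_prop
    exact hm.lintegral_prod_right'

lemma sup_est {Ω : Set E2} (ho : IsOpen Ω) {f : E2 → ℝ} (hf : ContDiffOn ℝ 2 f Ω)
    (i1 : IntegrableOn (fun x => (f x)^2) Ω)
    (i2 : IntegrableOn (fun x => ‖iteratedFDeriv ℝ 2 f x‖^2) Ω)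
    {s : ℝ} (hs : 0 < s) (hP : ∀ x ∈ Ω, ∃ c, x ∈ ball c s ∧ ball c s ⊆ Ω) {x : E2} (hx : x ∈ Ω) :
    (f x) ^ 2 * s ^ 2 ≤ 648 * (∫ x in Ω, (f x)^2) +
      32 * s ^ 4 * ∫ x in Ω, ‖iteratedFDeriv ℝ 2 f x‖^2 := by
  obtain ⟨c, hxc, hc⟩ := hP x hx
  have h := sup_est_enn ho hf hxc hc
  have ha : 0 ≤ ∫ x in Ω, (f x)^2 := integral_nonneg fun x => sq_nonneg _
  have hb : 0 ≤ ∫ x in Ω, ‖iteratedFDeriv ℝ 2 f x‖^2 := integral_nonneg fun x => sq_nonneg _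
  rw [lintegral_edens ho _ i1 i2, EuclideanSpace.volume_ball_fin_two] at h
  have e1 : ENNReal.ofReal s ^ 2 * ENNReal.ofReal Real.pi = ENNReal.ofReal (s ^ 2 * Real.pi) := by
    rw [ENNReal.ofReal_mul (by positivity), ENNReal.ofReal_pow hs.le]
  rw [e1, ← ENNReal.ofReal_mul (by positivity), ENNReal.ofReal_le_ofReal_iff (by positivity)] at h
  have := Real.pi_gt_three
  have q : 0 ≤ (f x) ^ 2 * s ^ 2 := by positivity
  nlinarith

lemma grad_est {Ω : Set E2} (ho : IsOpen Ω) {f : E2 → ℝ} (hf : ContDiffOn ℝ 2 f Ω)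
    (i1 : IntegrableOn (fun x => (f x)^2) Ω)
    (i3 : IntegrableOn (fun x => ‖fderiv ℝ f x‖^2) Ω)
    (i2 : IntegrableOn (fun x => ‖iteratedFDeriv ℝ 2 f x‖^2) Ω)
    {s : ℝ} (hs : 0 < s) (hP : ∀ x ∈ Ω, ∃ c, x ∈ ball c s ∧ ball c s ⊆ Ω) :
    (∫ x in Ω, ‖fderiv ℝ f x‖^2) * s ^ 2 ≤ 1024 * (648 * (∫ x in Ω, (f x)^2) +
      32 * s ^ 4 * ∫ x in Ω, ‖iteratedFDeriv ℝ 2 f x‖^2) := by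
  have h := grad_est_enn ho hf hs hP
  have ha : 0 ≤ ∫ x in Ω, (f x)^2 := integral_nonneg fun x => sq_nonneg _
  have hb : 0 ≤ ∫ x in Ω, ‖iteratedFDeriv ℝ 2 f x‖^2 := integral_nonneg fun x => sq_nonneg _
  have hd : 0 ≤ ∫ x in Ω, ‖fderiv ℝ f x‖^2 := integral_nonneg fun x => sq_nonneg _
  have e1 : ∀ s : ℝ, 0 < s →
      ENNReal.ofReal s ^ 2 * ENNReal.ofReal Real.pi = ENNReal.ofReal (s ^ 2 * Real.pi) := by
    intro s hs
    rw [ENNReal.ofReal_mul (by positivity), ENNReal.ofReal_pow hs.le]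
  have e2 : ∀ x, (‖fderiv ℝ f x‖ * (s / 4)) ^ 2 = ‖fderiv ℝ f x‖ ^ 2 * (s / 4) ^ 2 :=
    fun x => by ring
  simp_rw [e2] at h
  rw [lintegral_edens ho _ i1 i2, EuclideanSpace.volume_ball_fin_two,
    EuclideanSpace.volume_ball_fin_two, e1 _ (by positivity), e1 _ (by positivity),
    lintegral_mul_const' _ _ ENNReal.ofReal_ne_top,
    ← ofReal_integral_eq_lintegral_ofReal (i3.mul_const _)
      (Eventually.of_forall fun x => by positivity),
    integral_mul_const, ← ENNReal.ofReal_mul (by positivity), ← ENNReal.ofReal_mul (by positivity),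
    ENNReal.ofReal_le_ofReal_iff (by positivity)] at h
  set A := ∫ x in Ω, (f x)^2
  set B := ∫ x in Ω, ‖iteratedFDeriv ℝ 2 f x‖^2
  set G := ∫ x in Ω, ‖fderiv ℝ f x‖^2
  have hp : 0 < s ^ 2 * Real.pi := by positivity
  have hfin : (G * s ^ 2) * (s ^ 2 * Real.pi) ≤
      (1024 * (648 * A + 32 * s ^ 4 * B)) * (s ^ 2 * Real.pi) := by
    nlinarith
  exact le_of_mul_le_mul_right hfin hp

/-- Optimisation in the scale. -/
lemma optimise {a b u ρ : ℝ} (ha : 0 ≤ a) (hb : 0 ≤ b) (hρ : 0 < ρ)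
    (h : ∀ s, 0 < s → s ≤ ρ / 2 → u * s ≤ 832 * (a + s ^ 2 * b)) :
    u ≤ 3328 * (Real.sqrt (b * a) + a / ρ) := by
  have hq : 0 ≤ Real.sqrt (b * a) := Real.sqrt_nonneg _
  have har : 0 ≤ a / ρ := by positivity
  by_cases hc : b * (ρ / 2) ^ 2 ≤ a
  · have h1 := h (ρ / 2) (by positivity) le_rfl
    have h2 : u * (ρ / 2) ≤ (3328 * (a / ρ)) * (ρ / 2) := by
      have : a / ρ * ρ = a := by field_simp
      nlinarith
    have := le_of_mul_le_mul_right h2 (by positivity)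
    linarith
  · push Not at hc
    have hb' : 0 < b := by
      rcases hb.eq_or_lt with h0 | h0
      · rw [← h0] at hc; linarith
      · exact h0
    rcases ha.eq_or_lt with h0 | h0
    ·
      have hu : u ≤ 0 := by
        by_contra hu
        push Not at hu
        have hs : 0 < min (ρ / 2) (u / (1664 * b)) := by positivity
        have h1 := h _ hs (min_le_left _ _)
        have h2 := min_le_right (ρ / 2) (u / (1664 * b))
        set s := min (ρ / 2) (u / (1664 * b))
        rw [le_div_iff₀ (by positivity)] at h2
        rw [← h0] at h1
        have h3 : u * s ≤ (832 * s * b) * s := by nlinarith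
        have := le_of_mul_le_mul_right h3 hs
        linarith
      have : 0 ≤ 3328 * (Real.sqrt (b * a) + a / ρ) := by positivity
      linarith
    · set s := Real.sqrt (a / b) with hs
      have hs0 : 0 < s := Real.sqrt_pos.2 (by positivity)
      have hs2 : s ^ 2 * b = a := by
        rw [hs, Real.sq_sqrt (by positivity)]; field_simp
      have hsρ : s ≤ ρ / 2 := by
        rw [hs]
        apply Real.sqrt_le_iff.2
        refine ⟨by positivity, ?_⟩
        rw [div_le_iff₀ hb']; linarith
      have h1 := h s hs0 hsρ
      have h3 : Real.sqrt (b * a) = s * b := by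
        rw [← hs2, show b * (s ^ 2 * b) = (s * b) ^ 2 by ring, Real.sqrt_sq (by positivity)]
      rw [h3]
      have h4 : u * s ≤ (1664 * (s * b)) * s := by nlinarith
      have := le_of_mul_le_mul_right h4 hs0
      nlinarith [mul_pos hs0 hb']

lemma root_est {A B u s : ℝ} (hA : 0 ≤ A) (hB : 0 ≤ B) (hs : 0 < s)
    (h : u ^ 2 * s ^ 2 ≤ 1024 * (648 * A + 32 * s ^ 4 * B)) :
    u * s ≤ 832 * (Real.sqrt A + s ^ 2 * Real.sqrt B) := by
  have h1 := Real.sq_sqrt hA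
  have h2 := Real.sq_sqrt hB
  have h3 := Real.sqrt_nonneg A
  have h4 := Real.sqrt_nonneg B
  refine abs_le_of_sq_le_sq' ?_ (by positivity) |>.2
  have h5 : 0 ≤ Real.sqrt A * (s ^ 2 * Real.sqrt B) := by positivity
  have h6 : (s ^ 2 * Real.sqrt B) ^ 2 = s ^ 4 * B := by rw [mul_pow, h2]; ring
  have h7 : 0 ≤ s ^ 4 * B := by positivity
  nlinarith


/-- Lemma 2.7, quantified Gagliardo–Nirenberg interpolation: for UBC
domains, `‖∇f‖_{L²} ≤ C(‖∇²f‖_{L²}^{1/2}‖f‖_{L²}^{1/2} + ‖f‖_{L²}/r_Ω)` and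
`‖f‖_{L∞} ≤ C(‖∇²f‖_{L²}^{1/2}‖f‖_{L²}^{1/2} + ‖f‖_{L²}/r_Ω)` with an independent `C`. -/
theorem quantified_gagliardo_nirenberg :
    ∃ C : ℝ, ∀ Ω : Set E2, IsUBCDomain Ω → ∀ f : E2 → ℝ,
      ContDiffOn ℝ 2 f Ω →
      IntegrableOn (fun x => (f x)^2) Ω →
      IntegrableOn (fun x => ‖fderiv ℝ f x‖^2) Ω →
      IntegrableOn (fun x => ‖iteratedFDeriv ℝ 2 f x‖^2) Ω →
      (Real.sqrt (∫ x in Ω, ‖fderiv ℝ f x‖^2) ≤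
        C * (Real.sqrt (Real.sqrt (∫ x in Ω, ‖iteratedFDeriv ℝ 2 f x‖^2) *
              Real.sqrt (∫ x in Ω, (f x)^2)) +
            Real.sqrt (∫ x in Ω, (f x)^2) / ubcRadius Ω)) ∧
      (∀ x ∈ Ω, |f x| ≤
        C * (Real.sqrt (Real.sqrt (∫ x in Ω, ‖iteratedFDeriv ℝ 2 f x‖^2) *
              Real.sqrt (∫ x in Ω, (f x)^2)) +
            Real.sqrt (∫ x in Ω, (f x)^2) / ubcRadius Ω)) := by
  refine ⟨3328, fun Ω hΩ f hf i1 i3 i2 => ?_⟩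
  obtain ⟨ho, hcon, hbdd, r0, hr0⟩ := hΩ
  have hfr : (frontier Ω).Nonempty := by
    rw [nonempty_frontier_iff]
    refine ⟨hcon.nonempty, ?_⟩
    rintro rfl
    exact NoncompactSpace.noncompact_univ (X := E2)
      (by simpa using hbdd.isCompact_closure)
  have hbound : BddAbove {r : ℝ | IsUBCWith Ω r} := by
    obtain ⟨y, hy⟩ := hfr
    refine ⟨Metric.diam Ω, ?_⟩
    rintro r ⟨hr, h⟩
    obtain ⟨c, -, hc, -⟩ := h y hy
    have h1 : Metric.diam (ball c r) = 2 * r := by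
      rw [diam_ball_eq _ hr.le]
    have h2 := Metric.diam_mono hc hbdd
    linarith
  have hρ : 0 < ubcRadius Ω := hr0.1.trans_le (le_csSup hbound hr0)
  obtain ⟨r, hr, hrlt⟩ := exists_lt_of_lt_csSup ⟨r0, hr0⟩ (half_lt_self hρ)
  have hP : ∀ s, 0 < s → s ≤ ubcRadius Ω / 2 → ∀ x ∈ Ω, ∃ c, x ∈ ball c s ∧ ball c s ⊆ Ω :=
    fun s hs hsr x hx => exists_ball_shrink hs (hsr.trans hrlt.le) (exists_ball_of_ubc ho hfr hr hx)
  have ha : 0 ≤ ∫ x in Ω, (f x)^2 := integral_nonneg fun x => sq_nonneg _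
  have hb : 0 ≤ ∫ x in Ω, ‖iteratedFDeriv ℝ 2 f x‖^2 := integral_nonneg fun x => sq_nonneg _
  have hd : 0 ≤ ∫ x in Ω, ‖fderiv ℝ f x‖^2 := integral_nonneg fun x => sq_nonneg _
  constructor
  · refine optimise (Real.sqrt_nonneg _) (Real.sqrt_nonneg _) hρ (fun s hs hsr => ?_)
    refine root_est ha hb hs ?_
    rw [Real.sq_sqrt hd]
    exact grad_est ho hf i1 i3 i2 hs (hP s hs hsr)
  · intro x hx
    refine optimise (Real.sqrt_nonneg _) (Real.sqrt_nonneg _) hρ (fun s hs hsr => ?_)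
    refine root_est ha hb hs ?_
    rw [sq_abs]
    have h1 := sup_est ho hf i1 i2 hs (hP s hs hsr) hx
    have h2 : 0 ≤ 648 * (∫ x in Ω, (f x)^2) +
      32 * s ^ 4 * ∫ x in Ω, ‖iteratedFDeriv ℝ 2 f x‖^2 := by positivity
    linarith

end StokesPaper

end
end
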